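/- arXiv:2402.08274 — 4 statements merged into one kernel-verified Lean document; each statement's English description precedes it below -/
import Mathlib

section
/- Let A ⊆ F_2^t be a set of vectors such that ⟨v1, v2⟩ = 1 for all (not necessarily distinct) v1, v2 ∈ A. Then the linear span of A in F_2^t has dimension at most ⌊(t+1)/2⌋; in particular |A| ≤ 2^{(t+1)/2}. -/
/-- The inner product `⟨x,y⟩ = ∑ i, x i * y i`. -/
def ip {F : Type*} [CommRing F] {ι : Type*} [Fintype ι] (x y : ι → F) : F :=
  ∑ i, x i * y i

/-- if `A ⊆ F_2^t` satisfies `⟨v1, v2⟩ = 1` for all (not necessarily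
distinct) `v1, v2 ∈ A`, then the span of `A` has dimension at most `⌊(t+1)/2⌋`;
in particular `|A| ≤ 2^{(t+1)/2}`. -/
theorem span_dim_le_of_pairwise_ip_one {t : ℕ} (A : Set (Fin t → ZMod 2))
    (h : ∀ v1 ∈ A, ∀ v2 ∈ A, ip v1 v2 = 1) :
    Module.finrank (ZMod 2) (Submodule.span (ZMod 2) A) ≤ (t + 1) / 2 ∧
      (A.ncard : ℝ) ≤ (2 : ℝ) ^ (((t : ℝ) + 1) / 2) := by
  have hdim : Module.finrank (ZMod 2) (Submodule.span (ZMod 2) A) ≤ (t + 1) / 2 := by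
    rcases A.eq_empty_or_nonempty with rfl | ⟨v, hv⟩
    · rw [Submodule.span_empty, finrank_bot]
      exact Nat.zero_le _
    set W := Submodule.span (ZMod 2) A with hW
    let B : LinearMap.BilinForm (ZMod 2) (Fin t → ZMod 2) := Matrix.toBilin' 1
    have hBa : ∀ x y, B x y = ip x y := by
      intro x y
      simp [B, Matrix.toBilin'_apply', ip, dotProduct]
    have hB : B.Nondegenerate := by
      apply Matrix.nondegenerate_toBilin'_iff.mpr
      apply Matrix.nondegenerate_of_det_ne_zero
      simp
    have h1 := LinearMap.BilinForm.finrank_orthogonal hB W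
    have hle : W ≤ Submodule.span (ZMod 2) {v} ⊔ B.orthogonal W := by
      rw [hW, Submodule.span_le]
      intro a ha
      have : a = v + (a - v) := by abel
      rw [this]
      refine Submodule.add_mem_sup (Submodule.mem_span_singleton_self v) ?_
      rw [LinearMap.BilinForm.mem_orthogonal_iff]
      intro n hn
      change B n (a - v) = 0
      induction hn using Submodule.span_induction with
      | mem x hx => rw [map_sub, hBa, hBa, h x hx a ha, h x hx v hv, sub_self]
      | zero => simp
      | add x y _ _ hx hy => rw [map_add, LinearMap.add_apply, hx, hy, add_zero]
      | smul c x _ hx => rw [map_smul, LinearMap.smul_apply, hx, smul_zero]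
    have h2 := Submodule.finrank_mono hle
    have h3 := Submodule.finrank_add_le_finrank_add_finrank (Submodule.span (ZMod 2) {v}) (B.orthogonal W)
    have h4 := finrank_span_le_card (R := ZMod 2) ({v} : Set (Fin t → ZMod 2))
    rw [Set.toFinset_singleton, Finset.card_singleton] at h4
    have h5 := Submodule.finrank_le W
    have h6 : Module.finrank (ZMod 2) (Fin t → ZMod 2) = t := by simp
    omega
  refine ⟨hdim, ?_⟩
  have hc : A.ncard ≤ 2 ^ Module.finrank (ZMod 2) (Submodule.span (ZMod 2) A) := by
    have e1 : A.ncard ≤ (Submodule.span (ZMod 2) A : Set (Fin t → ZMod 2)).ncard :=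
      Set.ncard_le_ncard Submodule.subset_span (Set.toFinite _)
    have e2 := Module.natCard_eq_pow_finrank (K := ZMod 2) (V := Submodule.span (ZMod 2) A)
    rw [Nat.card_zmod] at e2
    rw [← e2]
    exact e1
  calc (A.ncard : ℝ) ≤ (2 : ℝ) ^ Module.finrank (ZMod 2) (Submodule.span (ZMod 2) A) := by
        exact_mod_cast hc
    _ = (2 : ℝ) ^ (Module.finrank (ZMod 2) (Submodule.span (ZMod 2) A) : ℝ) :=
        (Real.rpow_natCast _ _).symm
    _ ≤ _ := by
        apply Real.rpow_le_rpow_of_exponent_le (by norm_num)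
        have : 2 * Module.finrank (ZMod 2) (Submodule.span (ZMod 2) A) ≤ t + 1 := by omega
        have : (2 : ℝ) * Module.finrank (ZMod 2) (Submodule.span (ZMod 2) A) ≤ t + 1 := by
          exact_mod_cast this
        linarith
end

section
/- There exists a constant δ > 0 such that for all integers d ≥ k ≥ 2, there exists a set G of at least d^{δ·k/log k} vectors of F_2^d, each non-self-orthogonal, such that among every k+1 distinct vectors of G some two are orthogonal. -/
namespace NearlyOrth

open Finset Module

abbrev V (t : ℕ) := Fin t → ZMod 2

lemma zmod2_ne (x : ZMod 2) (h : x ≠ 0) : x = 1 := by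
  revert x; decide

lemma ip_comm' {ι : Type*} [Fintype ι] (x y : ι → ZMod 2) : ip x y = ip y x := by
  unfold ip; exact Finset.sum_congr rfl fun i _ => mul_comm _ _

/-- solutions of the affine system -/
lemma card_solutions {t : ℕ} (T : Set (V t)) (A : Finset (V t))
    (hA : ∀ v ∈ A, ∀ u ∈ T, ip u v = 1) :
    A.card * 2 ^ finrank (ZMod 2) (Submodule.span (ZMod 2) T) ≤ 2 ^ t := by
  classical
  set U := Submodule.span (ZMod 2) T with hU
  rcases A.eq_empty_or_nonempty with rfl | ⟨a, ha⟩
  · simp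
  let B : LinearMap.BilinForm (ZMod 2) (V t) := dotProductBilin (ZMod 2) (ZMod 2)
  have hBip : ∀ x y, B x y = ip x y := fun x y => rfl
  have hnd : B.Nondegenerate := by
    have key : ∀ x : V t, (∀ y, B x y = 0) → x = 0 := by
      intro x hx
      exact dotProduct_eq_zero x (fun y => hx y)
    refine ⟨fun x hx => key x hx, fun y hy => key y fun x => ?_⟩
    rw [hBip, ip_comm', ← hBip]; exact hy x
  have hrefl : B.IsRefl := by
    intro x y h
    rw [hBip, ip_comm', ← hBip]; exact h
  have hfin := LinearMap.BilinForm.finrank_orthogonal hnd U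
  have hle : finrank (ZMod 2) U ≤ t := by
    have := Submodule.finrank_le U
    simpa using this
  have hft : finrank (ZMod 2) (V t) = t := by simp
  rw [hft] at hfin
  have hcard : Nat.card (B.orthogonal U) = 2 ^ (t - finrank (ZMod 2) U) := by
    rw [Module.natCard_eq_pow_finrank (K := ZMod 2), hfin]; simp
  have hmem : ∀ v ∈ A, v - a ∈ B.orthogonal U := by
    intro v hv
    rw [LinearMap.BilinForm.mem_orthogonal_iff]
    intro n hn
    change B n (v - a) = 0
    have : U ≤ LinearMap.ker (B.flip (v - a)) := by
      rw [hU, Submodule.span_le]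
      intro u hu
      simp only [SetLike.mem_coe, LinearMap.mem_ker]
      change B u (v - a) = 0
      rw [map_sub, hBip, hBip, hA v hv u hu, hA a ha u hu, sub_self]
    exact this hn
  have hAc : A.card ≤ 2 ^ (t - finrank (ZMod 2) U) := by
    rw [← hcard]
    have : Function.Injective (fun v : A => (⟨v.1 - a, hmem v.1 v.2⟩ : B.orthogonal U)) := by
      intro v w h
      have := congrArg Subtype.val h
      exact Subtype.ext (sub_left_injective this)
    have := Nat.card_le_card_of_injective _ this
    simpa using this
  calc _ ≤ 2 ^ (t - finrank (ZMod 2) U) * 2 ^ finrank (ZMod 2) U := Nat.mul_le_mul_right _ hAc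
    _ = 2 ^ t := by rw [← pow_add, Nat.sub_add_cancel hle]

open Classical in
/-- tuples of length `j` that are cliques and joined to `T` -/
noncomputable def cl (t j : ℕ) (T : Set (V t)) : Finset (Fin j → V t) :=
  Finset.univ.filter fun z => (∀ i, ∀ u ∈ T, ip u (z i) = 1) ∧ ∀ i i', i < i' → ip (z i) (z i') = 1

open Classical in
lemma cl_succ (t j : ℕ) (T : Set (V t)) :
    (cl t (j+1) T).card ≤
      ∑ v ∈ Finset.univ.filter (fun v : V t => ∀ u ∈ T, ip u v = 1), (cl t j (insert v T)).card := by
  rw [Finset.card_eq_sum_card_fiberwise (f := fun z : Fin (j+1) → V t => z 0)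
    (t := Finset.univ.filter (fun v : V t => ∀ u ∈ T, ip u v = 1))]
  · refine Finset.sum_le_sum fun v _ => ?_
    refine Finset.card_le_card_of_injOn (fun z => Fin.tail z) ?_ ?_
    · intro z hz
      simp only [cl, coe_filter, mem_filter, mem_univ, true_and, Set.mem_ofPred_eq] at hz ⊢
      obtain ⟨⟨h1, h2⟩, h3⟩ := hz
      refine ⟨fun i u hu => ?_, fun i i' h => h2 _ _ (Fin.succ_lt_succ_iff.2 h)⟩
      rcases hu with rfl | hu
      · rw [← h3]; exact h2 _ _ (Fin.succ_pos i)
      · exact h1 _ u hu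
    · intro z hz w hw h
      simp only [coe_filter, Set.mem_ofPred_eq] at hz hw
      rw [← Fin.cons_self_tail z, ← Fin.cons_self_tail w, hz.2, hw.2]
      simp only at h
      rw [h]
  · intro z hz
    simp only [cl, coe_filter, mem_univ, true_and, Set.mem_ofPred_eq] at hz ⊢
    exact hz.1 0

lemma cl_bound (t j : ℕ) : ∀ (T : Set (V t)) (r : ℕ),
    finrank (ZMod 2) (Submodule.span (ZMod 2) T) = r → 2 * (r + j) ≤ t →
    (cl t j T).card * 2 ^ (∑ i ∈ range j, (r + i)) ≤ 2 ^ j * 2 ^ (t * j) := by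
  classical
  induction j with
  | zero =>
    intro T r _ _
    have : (cl t 0 T).card ≤ 1 := by
      refine (Finset.card_le_univ _).trans ?_
      simp
    simpa using this
  | succ j ih =>
    intro T r hr ht
    set A := Finset.univ.filter (fun v : V t => ∀ u ∈ T, ip u v = 1) with hA
    set U := Submodule.span (ZMod 2) T with hU
    have hAcard : A.card * 2 ^ r ≤ 2 ^ t := by
      rw [← hr]
      exact card_solutions T A (fun v hv => by simpa [hA] using hv)
    have hUcard : (A.filter (fun v => v ∈ U)).card ≤ 2 ^ r := by
      have h1 : Nat.card U = 2 ^ r := by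
        rw [Module.natCard_eq_pow_finrank (K := ZMod 2), hr]; simp
      rw [← h1]
      have hh : Function.Injective
          (fun v : {v // v ∈ A.filter (fun v => v ∈ U)} =>
            (⟨v.1, (Finset.mem_filter.1 v.2).2⟩ : U)) := by
        intro v w h
        exact Subtype.ext (congrArg (fun u : U => u.1) h)
      have := Nat.card_le_card_of_injective _ hh
      rwa [Nat.card_eq_fintype_card, Fintype.card_coe] at this
    have hs1 : ∑ i ∈ range (j+1), (r + i) = (∑ i ∈ range j, (r + i)) + (r + j) :=
      Finset.sum_range_succ _ _
    have hs2 : ∑ i ∈ range (j+1), (r + i) = (∑ i ∈ range j, (r + 1 + i)) + r := by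
      rw [Finset.sum_range_succ']
      simp only [add_zero, add_left_inj]
      exact Finset.sum_congr rfl fun i _ => by ring
    have hin : ∀ v ∈ A.filter (fun v => v ∈ U),
        (cl t j (insert v T)).card * 2 ^ (∑ i ∈ range (j+1), (r + i))
          ≤ 2 ^ j * 2 ^ (t * j) * 2 ^ (r + j) := by
      intro v hv
      have hvU := (Finset.mem_filter.1 hv).2
      have h := ih (insert v T) r (by rw [Submodule.span_insert_eq_span hvU]; exact hr) (by omega)
      rw [hs1, pow_add, ← mul_assoc]
      exact Nat.mul_le_mul_right _ h
    have hout : ∀ v ∈ A.filter (fun v => ¬ v ∈ U),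
        (cl t j (insert v T)).card * 2 ^ (∑ i ∈ range (j+1), (r + i))
          ≤ 2 ^ j * 2 ^ (t * j) * 2 ^ r := by
      intro v hv
      have hvU := (Finset.mem_filter.1 hv).2
      have hrk : finrank (ZMod 2) (Submodule.span (ZMod 2) (insert v T)) = r + 1 := by
        rw [Submodule.span_insert, sup_comm, ← hr]
        exact Submodule.finrank_sup_span_singleton hvU
      have h := ih (insert v T) (r + 1) hrk (by omega)
      rw [hs2, pow_add, ← mul_assoc]
      exact Nat.mul_le_mul_right _ h
    calc (cl t (j+1) T).card * 2 ^ (∑ i ∈ range (j+1), (r + i))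
        ≤ (∑ v ∈ A, (cl t j (insert v T)).card) * 2 ^ (∑ i ∈ range (j+1), (r + i)) :=
          Nat.mul_le_mul_right _ (cl_succ t j T)
      _ = ∑ v ∈ A, (cl t j (insert v T)).card * 2 ^ (∑ i ∈ range (j+1), (r + i)) := by
          rw [Finset.sum_mul]
      _ = ∑ v ∈ A.filter (fun v => v ∈ U),
            (cl t j (insert v T)).card * 2 ^ (∑ i ∈ range (j+1), (r + i))
          + ∑ v ∈ A.filter (fun v => ¬ v ∈ U),
            (cl t j (insert v T)).card * 2 ^ (∑ i ∈ range (j+1), (r + i)) := by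
          rw [Finset.sum_filter_add_sum_filter_not]
      _ ≤ (A.filter (fun v => v ∈ U)).card * (2 ^ j * 2 ^ (t * j) * 2 ^ (r + j))
          + (A.filter (fun v => ¬ v ∈ U)).card * (2 ^ j * 2 ^ (t * j) * 2 ^ r) := by
          refine Nat.add_le_add ?_ ?_
          · simpa using Finset.sum_le_card_nsmul _ _ _ hin
          · simpa using Finset.sum_le_card_nsmul _ _ _ hout
      _ ≤ 2 ^ r * (2 ^ j * 2 ^ (t * j) * 2 ^ (r + j)) + A.card * (2 ^ j * 2 ^ (t * j) * 2 ^ r) := by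
          refine Nat.add_le_add (Nat.mul_le_mul_right _ hUcard)
            (Nat.mul_le_mul_right _ (Finset.card_filter_le _ _))
      _ = 2 ^ j * 2 ^ (t * j) * 2 ^ (r + (r + j)) + 2 ^ j * 2 ^ (t * j) * (A.card * 2 ^ r) := by
          rw [pow_add 2 r (r + j)]; ring
      _ ≤ 2 ^ j * 2 ^ (t * j) * 2 ^ t + 2 ^ j * 2 ^ (t * j) * 2 ^ t := by
          refine Nat.add_le_add (Nat.mul_le_mul_left _ ?_) (Nat.mul_le_mul_left _ hAcard)
          exact Nat.pow_le_pow_right (by norm_num) (by omega)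
      _ = 2 ^ (j+1) * 2 ^ (t * (j+1)) := by ring

/-- odd vectors -/
abbrev Odd' (t : ℕ) := {v : V t // ip v v = 1}

lemma card_odd (n : ℕ) : 2 ^ n ≤ Nat.card (Odd' (n+1)) := by
  have hsq : ∀ x : ZMod 2, x * x = x := by decide
  let f : V n → Odd' (n+1) := fun u => ⟨Fin.cons (1 - ∑ i, u i) u, by
    simp [ip, Fin.sum_univ_succ, hsq]⟩
  have hf : Function.Injective f := by
    intro u w h
    have := congrArg Subtype.val h
    funext i
    have h2 := congrFun this i.succ
    simpa [f] using h2
  have := Nat.card_le_card_of_injective f hf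
  simpa using this

def tens {s t : ℕ} (w : Fin s → V t) : (Fin s → Fin t) → ZMod 2 := fun f => ∏ l, w l (f l)

lemma ip_tens {s t : ℕ} (w w' : Fin s → V t) : ip (tens w) (tens w') = ∏ l, ip (w l) (w' l) := by
  classical
  unfold ip tens
  rw [Finset.prod_univ_sum]
  simp [Finset.prod_mul_distrib]

/-- existence of a clique free sequence -/
lemma exists_seq (Ω : Type) [Fintype Ω] (R : Ω → Ω → Prop) (N m C : ℕ)
    (hC : Nat.card {y : Fin m → Ω // ∀ i i', i < i' → R (y i) (y i')} ≤ C)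
    (h : N ^ m * C < Nat.card Ω ^ m) (hΩ : 0 < Nat.card Ω) :
    ∃ x : Fin N → Ω, ∀ e : Fin m → Fin N, Function.Injective e →
      ∃ i i', i < i' ∧ ¬ R (x (e i)) (x (e i')) := by
  classical
  by_contra hcon
  push Not at hcon
  by_cases hmN : m ≤ N
  swap
  · -- no injections
    have : Nonempty Ω := (Nat.card_pos_iff.1 hΩ).1
    obtain ⟨e, he, _⟩ := hcon (fun _ => Classical.arbitrary Ω)
    have := Fintype.card_le_of_injective e he
    simp at this
    omega
  let Bad : (Fin m → Fin N) → Finset (Fin N → Ω) := fun e =>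
    if Function.Injective e then
      Finset.univ.filter fun x => ∀ i i', i < i' → R (x (e i)) (x (e i')) else ∅
  have hbad : ∀ e, (Bad e).card ≤ C * Nat.card Ω ^ (N - m) := by
    intro e
    by_cases he : Function.Injective e
    swap
    · simp [Bad, he]
    let g : Bad e → {y : Fin m → Ω // ∀ i i', i < i' → R (y i) (y i')} ×
        ({a : Fin N // a ∉ Set.range e} → Ω) :=
      fun x => (⟨x.1 ∘ e, by
        have := x.2
        simp only [Bad, he, if_true, mem_filter, mem_univ, true_and] at this
        exact this⟩, fun a => x.1 a.1)
    have hg : Function.Injective g := by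
      intro x y hxy
      apply Subtype.ext
      funext a
      by_cases ha : a ∈ Set.range e
      · obtain ⟨i, rfl⟩ := ha
        exact congrFun (congrArg (fun p => p.1.1) hxy) i
      · exact congrFun (congrArg (fun p => p.2) hxy) ⟨a, ha⟩
    have h1 := Nat.card_le_card_of_injective g hg
    have h2 : Nat.card {a : Fin N // a ∉ Set.range e} = N - m := by
      rw [Nat.card_eq_fintype_card, Fintype.card_subtype_compl]
      have h3 : Fintype.card {a : Fin N // a ∈ Set.range e} = m := by
        rw [← Nat.card_eq_fintype_card]
        have := Nat.card_congr (Equiv.ofInjective e he)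
        rw [Nat.card_fin] at this
        exact this.symm
      rw [h3, Fintype.card_fin]
    rw [Nat.card_prod, Nat.card_fun, h2] at h1
    simp only [Nat.card_eq_fintype_card, Fintype.card_coe] at h1 hC ⊢
    exact h1.trans (Nat.mul_le_mul_right _ hC)
  have hcover : (Finset.univ : Finset (Fin N → Ω)) ⊆ Finset.univ.biUnion Bad := by
    intro x _
    obtain ⟨e, he, hx⟩ := hcon x
    simp only [mem_biUnion, mem_univ, true_and]
    refine ⟨e, ?_⟩
    simp only [Bad, he, if_true, mem_filter, mem_univ, true_and]
    exact hx
  have hle := (Finset.card_le_card hcover).trans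
    (Finset.card_biUnion_le_card_mul _ _ _ (fun e _ => hbad e))
  have hΩc : Fintype.card Ω = Nat.card Ω := (Nat.card_eq_fintype_card).symm
  simp only [Finset.card_univ, Fintype.card_fun, Fintype.card_fin, hΩc] at hle
  have hlt : N ^ m * (C * Nat.card Ω ^ (N - m)) < Nat.card Ω ^ N := by
    calc N ^ m * (C * Nat.card Ω ^ (N - m)) = (N ^ m * C) * Nat.card Ω ^ (N - m) := by ring
      _ < Nat.card Ω ^ m * Nat.card Ω ^ (N - m) := Nat.mul_lt_mul_of_pos_right h (pow_pos hΩ _)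
      _ = Nat.card Ω ^ N := by rw [← pow_add]; congr 1; omega
  omega

lemma two_sum (m : ℕ) : 2 * ∑ i ∈ range m, (0 + i) = m * (m - 1) := by
  simp only [zero_add]
  rw [mul_comm, Finset.sum_range_id_mul_two]

lemma clique_count (k m q : ℕ) (hm : 2 * m ≤ k) (hq : 2 * q + 5 < m) :
    (2 ^ q) ^ m * (cl k m ∅).card < Nat.card (Odd' k) ^ m := by
  obtain ⟨n, rfl⟩ : ∃ n, k = n + 1 := ⟨k - 1, by omega⟩
  have hb := cl_bound (n+1) m ∅ 0 (by simp) (by omega)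
  have ho := Nat.pow_le_pow_left (card_odd n) m
  refine lt_of_lt_of_le ?_ ho
  set S := ∑ i ∈ range m, (0 + i) with hS
  have h2 := two_sum m
  rw [← hS] at h2
  have hpos : 0 < 2 ^ S := by positivity
  refine lt_of_mul_lt_mul_right (a := 2 ^ S) ?_ (Nat.zero_le _)
  calc (2 ^ q) ^ m * (cl (n+1) m ∅).card * 2 ^ S
      = (2 ^ q) ^ m * ((cl (n+1) m ∅).card * 2 ^ S) := by ring
    _ ≤ (2 ^ q) ^ m * (2 ^ m * 2 ^ ((n+1) * m)) := Nat.mul_le_mul_left _ hb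
    _ = 2 ^ (q * m + (m + (n+1) * m)) := by rw [← pow_mul, ← pow_add, ← pow_add]
    _ < 2 ^ (n * m + S) := by
        apply Nat.pow_lt_pow_right (by norm_num)
        obtain ⟨p, rfl⟩ : ∃ p, m = p + 1 := ⟨m - 1, by omega⟩
        simp only [Nat.add_sub_cancel] at h2
        nlinarith
    _ = (2 ^ n) ^ m * 2 ^ S := by rw [← pow_mul, ← pow_add]

lemma tensor_count (s k m : ℕ) :
    Nat.card {y : Fin m → (Fin s → Odd' k) // ∀ i i', i < i' →
      ∀ l, ip (y i l).1 (y i' l).1 = 1} ≤ (cl k m ∅).card ^ s := by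
  classical
  let g : {y : Fin m → (Fin s → Odd' k) // ∀ i i', i < i' → ∀ l, ip (y i l).1 (y i' l).1 = 1} →
      (Fin s → cl k m ∅) := fun y l => ⟨fun i => (y.1 i l).1, by
        simp only [cl, mem_filter, mem_univ, true_and]
        exact ⟨fun i u hu => absurd hu (Set.notMem_empty u), fun i i' h => y.2 i i' h l⟩⟩
  have hg : Function.Injective g := by
    intro y z h
    apply Subtype.ext
    funext i l
    apply Subtype.ext
    exact congrFun (congrArg Subtype.val (congrFun h l)) i
  have := Nat.card_le_card_of_injective g hg
  simpa using this

lemma ip_extend {ι κ : Type*} [Fintype ι] [Fintype κ] (g : ι ↪ κ) (v w : ι → ZMod 2) :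
    ip (Function.extend g v 0) (Function.extend g w 0) = ip v w := by
  classical
  unfold ip
  have : ∀ j ∈ (Finset.univ : Finset κ), j ∉ Finset.univ.map g →
      Function.extend g v 0 j * Function.extend g w 0 j = 0 := by
    intro j _ hj
    have : ¬ ∃ a, g a = j := by simpa using hj
    rw [Function.extend_apply' _ _ _ this]; simp
  rw [← Finset.sum_subset (Finset.subset_univ _) this, Finset.sum_map]
  simp [g.injective.extend_apply]

/-- the construction -/
lemma construction (d k s m q : ℕ) (hs : 1 ≤ s) (hd : k ^ s ≤ d) (hm : 2 * m ≤ k)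
    (hq : 2 * q + 5 < m) :
    ∃ G : Finset (Fin d → ZMod 2), 2 ^ (q * s) ≤ m * G.card ∧ (∀ v ∈ G, ip v v = 1) ∧
      (∀ S ⊆ G, S.card = k + 1 → ∃ v1 ∈ S, ∃ v2 ∈ S, v1 ≠ v2 ∧ ip v1 v2 = 0) := by
  classical
  let Ω := Fin s → Odd' k
  have hcc := clique_count k m q hm hq
  have hΩ : Nat.card Ω = Nat.card (Odd' k) ^ s := by
    simp only [Ω, Nat.card_fun]; simp
  have ho : 0 < Nat.card (Odd' k) := by
    by_contra h0
    have : Nat.card (Odd' k) = 0 := by omega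
    rw [this, zero_pow (by omega)] at hcc
    omega
  obtain ⟨x, hx⟩ := exists_seq Ω (fun a b => ∀ l, ip (a l).1 (b l).1 = 1) (2 ^ (q * s)) m
    ((cl k m ∅).card ^ s) (tensor_count s k m) (by
      rw [hΩ]
      calc (2 ^ (q * s)) ^ m * (cl k m ∅).card ^ s = ((2 ^ q) ^ m * (cl k m ∅).card) ^ s := by
            rw [mul_pow, ← pow_mul, ← pow_mul, ← pow_mul]; congr 2; ring
        _ < (Nat.card (Odd' k) ^ m) ^ s := Nat.pow_lt_pow_left hcc (by omega)
        _ = (Nat.card (Odd' k) ^ s) ^ m := by rw [← pow_mul, ← pow_mul, mul_comm])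
    (by rw [hΩ]; positivity)
  obtain ⟨g⟩ : Nonempty ((Fin s → Fin k) ↪ Fin d) := by
    apply Function.Embedding.nonempty_of_card_le
    simpa using hd
  let τ : Fin (2 ^ (q * s)) → (Fin d → ZMod 2) := fun i =>
    Function.extend g (tens fun l => (x i l).1) 0
  have hτ : ∀ i j, ip (τ i) (τ j) = ∏ l, ip (x i l).1 (x j l).1 := by
    intro i j
    simp only [τ, ip_extend, ip_tens]
  have hτ1 : ∀ i, ip (τ i) (τ i) = 1 := by
    intro i
    rw [hτ]
    exact Finset.prod_eq_one fun l _ => (x i l).2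
  -- clique of indices is small
  have hclique : ∀ I : Finset (Fin (2 ^ (q * s))), (∀ i ∈ I, ∀ j ∈ I, i ≠ j → ip (τ i) (τ j) ≠ 0) →
      I.card < m := by
    intro I hI
    by_contra hlt
    push Not at hlt
    obtain ⟨J, hJI, hJ⟩ := Finset.exists_subset_card_eq hlt
    let e := J.orderEmbOfFin hJ
    obtain ⟨i, i', hii, hn⟩ := hx e e.injective
    apply hn
    intro l
    apply zmod2_ne
    have := hI (e i) (hJI (Finset.orderEmbOfFin_mem J hJ i)) (e i')
      (hJI (Finset.orderEmbOfFin_mem J hJ i')) (fun h => hii.ne (e.injective h))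
    rw [hτ] at this
    exact (Finset.prod_ne_zero_iff.1 this) l (mem_univ _)
  refine ⟨Finset.univ.image τ, ?_, ?_, ?_⟩
  · have := Finset.card_le_mul_card_image (f := τ) (Finset.univ) m (by
      intro b _
      refine (hclique _ ?_).le
      intro i hi j hj _
      simp only [mem_filter, mem_univ, true_and] at hi hj
      rw [hj, ← hi, hτ1]
      exact one_ne_zero)
    simpa using this
  · intro v hv
    obtain ⟨i, _, rfl⟩ := Finset.mem_image.1 hv
    exact hτ1 i
  · intro S hS hSc
    by_contra hcon
    push Not at hcon
    have hpre : ∀ v : S, ∃ i, τ i = v.1 := fun v => by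
      obtain ⟨i, _, h⟩ := Finset.mem_image.1 (hS v.2)
      exact ⟨i, h⟩
    choose p hp using hpre
    have hpinj : Function.Injective p := by
      intro v w h
      apply Subtype.ext
      rw [← hp v, ← hp w, h]
    have := hclique (Finset.univ.image p) (by
      intro i hi j hj hij
      obtain ⟨v, _, rfl⟩ := Finset.mem_image.1 hi
      obtain ⟨w, _, rfl⟩ := Finset.mem_image.1 hj
      rw [hp, hp]
      refine hcon _ v.2 _ w.2 ?_
      intro h
      exact hij (congrArg p (Subtype.ext h)))
    rw [Finset.card_image_of_injective _ hpinj] at this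
    simp at this
    omega

/-- the standard basis -/
lemma basis_set (d : ℕ) : ∃ G : Finset (Fin d → ZMod 2), G.card = d ∧ (∀ v ∈ G, ip v v = 1) ∧
    (∀ v ∈ G, ∀ w ∈ G, v ≠ w → ip v w = 0) := by
  classical
  have hinj : Function.Injective (fun i : Fin d => (Pi.single i 1 : Fin d → ZMod 2)) := by
    intro i j h
    by_contra hij
    have := congrFun h i
    simp [Pi.single_apply, hij] at this
  refine ⟨Finset.univ.image (fun i : Fin d => (Pi.single i 1 : Fin d → ZMod 2)), ?_, ?_, ?_⟩
  · rw [Finset.card_image_of_injective _ hinj]; simp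
  · intro v hv
    obtain ⟨i, _, rfl⟩ := Finset.mem_image.1 hv
    simp [ip, Pi.single_apply]
  · intro v hv w hw h
    obtain ⟨i, _, rfl⟩ := Finset.mem_image.1 hv
    obtain ⟨j, _, rfl⟩ := Finset.mem_image.1 hw
    have : i ≠ j := fun h' => h (by rw [h'])
    simp [ip, Pi.single_apply, this.symm]

lemma aux_pow (a : ℕ) (ha : 8 ≤ a) : 8 * a + 8 ≤ 2 ^ a := by
  induction a, ha using Nat.le_induction with
  | base => norm_num
  | succ n hn ih => rw [pow_succ]; omega

end NearlyOrth

/-- there is a constant `δ > 0` such that for all integers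
`d ≥ k ≥ 2`, there is a set `G` of at least `d^{δ k / log k}` vectors of `F_2^d`,
each non-self-orthogonal, such that among every `k+1` distinct vectors of `G`
some two are orthogonal (logarithms in base 2). -/
theorem nearly_orthogonal_F2 :
    ∃ δ : ℝ, 0 < δ ∧ ∀ d k : ℕ, 2 ≤ k → k ≤ d →
      ∃ G : Finset (Fin d → ZMod 2),
        (d : ℝ) ^ (δ * k / Real.logb 2 k) ≤ (G.card : ℝ) ∧
        (∀ v ∈ G, ip v v = 1) ∧
        (∀ S ⊆ G, S.card = k + 1 →
          ∃ v1 ∈ S, ∃ v2 ∈ S, v1 ≠ v2 ∧ ip v1 v2 = 0) := by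
  refine ⟨1 / 128, by norm_num, fun d k hk hkd => ?_⟩
  have hd1 : (1 : ℝ) ≤ d := by exact_mod_cast (by omega : 1 ≤ d)
  have hk2 : (2 : ℝ) ≤ k := by exact_mod_cast hk
  have hlog : 1 ≤ Real.logb 2 k := by
    rw [Real.le_logb_iff_rpow_le (by norm_num) (by linarith)]
    simpa using hk2
  by_cases hsmall : k < 128
  · obtain ⟨G, hG, h1, h2⟩ := NearlyOrth.basis_set d
    refine ⟨G, ?_, h1, ?_⟩
    · rw [hG]
      have : (1 / 128 : ℝ) * k / Real.logb 2 k ≤ 1 := by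
        rw [div_le_one (by linarith)]
        have : (k : ℝ) ≤ 128 := by exact_mod_cast hsmall.le
        linarith
      calc (d : ℝ) ^ ((1 / 128 : ℝ) * k / Real.logb 2 k) ≤ (d : ℝ) ^ (1 : ℝ) :=
            Real.rpow_le_rpow_of_exponent_le hd1 this
        _ = d := Real.rpow_one _
    · intro S hS hc
      obtain ⟨v, hv, w, hw, hvw⟩ := Finset.one_lt_card.1 (by omega : 1 < S.card)
      exact ⟨v, hv, w, hw, hvw, h2 v (hS hv) w (hS hw) hvw⟩
  · push Not at hsmall
    set s := Nat.log k d with hs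
    have hs1 : 1 ≤ s := Nat.log_pos (by omega) hkd
    have hsd : k ^ s ≤ d := Nat.pow_log_le_self k (by omega)
    have hds : d < k ^ (s + 1) := Nat.lt_pow_succ_log_self (by omega) d
    obtain ⟨G, hG, h1, h2⟩ := NearlyOrth.construction d k s (k / 2) (k / 8) hs1 hsd (by omega)
      (by omega)
    refine ⟨G, ?_, h1, h2⟩
    set a := k / 16 with ha
    have hmle : k / 2 ≤ 2 ^ a := le_trans (by omega) (NearlyOrth.aux_pow a (by omega))
    have hGc : 2 ^ (a * s) ≤ G.card := by
      have h3 : 2 ^ a * 2 ^ (a * s) ≤ 2 ^ a * G.card := by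
        calc 2 ^ a * 2 ^ (a * s) = 2 ^ (a + a * s) := by rw [pow_add]
          _ ≤ 2 ^ (k / 8 * s) := by
            apply Nat.pow_le_pow_right (by norm_num)
            have : 2 * a ≤ k / 8 := by omega
            nlinarith
          _ ≤ k / 2 * G.card := hG
          _ ≤ 2 ^ a * G.card := Nat.mul_le_mul_right _ hmle
      exact Nat.le_of_mul_le_mul_left h3 (by positivity)
    have hGr : (2 : ℝ) ^ ((a * s : ℕ) : ℝ) ≤ G.card := by
      rw [Real.rpow_natCast]; exact_mod_cast hGc
    refine le_trans ?_ hGr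
    have hkpos : (0 : ℝ) < k := by linarith
    have hdk : (d : ℝ) ≤ (2 : ℝ) ^ (Real.logb 2 k * (s + 1)) := by
      rw [Real.rpow_mul (by norm_num), Real.rpow_logb (by norm_num) (by norm_num) hkpos]
      have : (d : ℝ) ≤ (k : ℝ) ^ (s + 1) := by exact_mod_cast hds.le
      refine this.trans (le_of_eq ?_)
      rw [← Real.rpow_natCast]; push_cast; rfl
    calc (d : ℝ) ^ ((1 / 128 : ℝ) * k / Real.logb 2 k)
        ≤ ((2 : ℝ) ^ (Real.logb 2 k * (s + 1))) ^ ((1 / 128 : ℝ) * k / Real.logb 2 k) :=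
          Real.rpow_le_rpow (by linarith) hdk (by positivity)
      _ = (2 : ℝ) ^ ((1 / 128 : ℝ) * k * (s + 1)) := by
          rw [← Real.rpow_mul (by norm_num)]
          congr 1
          field_simp
      _ ≤ (2 : ℝ) ^ ((a * s : ℕ) : ℝ) := by
          apply Real.rpow_le_rpow_of_exponent_le (by norm_num)
          push_cast
          have h4 : (k : ℝ) ≤ 32 * a := by exact_mod_cast (by omega : k ≤ 32 * a)
          have h5 : (1 : ℝ) ≤ s := by exact_mod_cast hs1
          nlinarith
end

section
/- For every prime p there exists δ = δ(p) > 0 such that for every field F of characteristic p and all integers k ≥ 2 and d ≥ k^{1/(p-1)}, there exists a set G of non-self-orthogonal vectors of F^d with |G| ≥ d^{δ·k^{1/(p-1)}/log k}, such that for every two subsets G1, G2 ⊆ G with |G1| = |G2| = k there exist v1 ∈ G1, v2 ∈ G2 with ⟨v1, v2⟩ = 0. -/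
section NearlyOrth
open Finset

open Classical in
lemma aux_card_nonorth {K : Type} [Field K] [Fintype K] {n : ℕ} (s : Set (Fin n → K))
    (T : Finset (Fin n → K)) (hT : ∀ b ∈ T, ∀ a ∈ s, ip a b ≠ 0) :
    T.card *
      Fintype.card K ^ (Module.finrank K (Submodule.span K s)) ≤
    (Fintype.card K - 1) ^ (Module.finrank K (Submodule.span K s)) * Fintype.card K ^ n := by
  obtain ⟨f, hf, -, hli⟩ := Submodule.exists_fun_fin_finrank_span_eq K s
  generalize Module.finrank K (Submodule.span K s) = r at f hf hli
  let M : Matrix (Fin r) (Fin n) K := Matrix.of f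
  have hrank : M.rank = Fintype.card (Fin r) := LinearIndependent.rank_matrix hli
  have hsurj : Function.Surjective M.mulVecLin := by
    rw [← LinearMap.range_eq_top]
    apply Submodule.eq_top_of_finrank_eq
    have : M.rank = Module.finrank K (LinearMap.range M.mulVecLin) := rfl
    rw [← this, hrank]; simp
  obtain ⟨g, hg⟩ := hsurj.hasRightInverse
  have key : (T ×ˢ
      (univ : Finset (Fin r → K))).card ≤
      ((Fintype.piFinset (fun _ : Fin r => (univ.erase (0 : K)))) ×ˢ
        (univ : Finset (Fin n → K))).card := by
    apply Finset.card_le_card_of_injOn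
      (fun x => (M.mulVecLin x.1, x.1 + g x.2))
    · rintro ⟨b, y⟩ hx
      simp only [coe_product, Set.mem_prod, mem_coe, mem_filter, mem_univ, true_and,
        and_true] at hx
      simp only [coe_product, Set.mem_prod, mem_coe, mem_univ, and_true, Fintype.mem_piFinset,
        mem_erase]
      intro i
      exact hT b hx (f i) (hf i)
    · rintro ⟨b, y⟩ - ⟨b', y'⟩ - h
      simp only [Prod.mk.injEq] at h
      obtain ⟨h1, h2⟩ := h
      have h3 := congrArg M.mulVecLin h2
      rw [map_add, map_add, hg, hg, h1] at h3
      have h4 := add_left_cancel h3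
      subst h4
      have h5 := add_right_cancel h2
      rw [h5]
  simpa [Finset.card_product, Fintype.card_piFinset, Finset.card_erase_of_mem] using key

lemma aux_card_submodule {K : Type} [Field K] [Fintype K] {n : ℕ}
    [Fintype (Submodule K (Fin n → K))] :
    Fintype.card (Submodule K (Fin n → K)) ≤ Fintype.card K ^ (n * n) := by
  classical
  have h : Function.Surjective (fun c : Fin n → (Fin n → K) => Submodule.span K (Set.range c)) := by
    intro W
    obtain ⟨f, hf, hs, -⟩ := Submodule.exists_fun_fin_finrank_span_eq K (W : Set (Fin n → K))
    replace hs := hs.trans (Submodule.span_eq W)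
    have hr : Module.finrank K (Submodule.span K (W : Set (Fin n → K))) ≤ n := by
      simpa using Submodule.finrank_le (Submodule.span K (W : Set (Fin n → K)))
    generalize Module.finrank K (Submodule.span K (W : Set (Fin n → K))) = r at f hf hs hr
    refine ⟨fun i => if h : i.1 < r then f ⟨i.1, h⟩ else 0, ?_⟩
    apply le_antisymm
    · rw [Submodule.span_le]
      rintro _ ⟨i, rfl⟩
      dsimp only
      split_ifs
      · exact hf _
      · exact W.zero_mem
    · rw [← hs, Submodule.span_le]
      rintro _ ⟨i, rfl⟩
      apply Submodule.subset_span
      exact ⟨⟨i.1, lt_of_lt_of_le i.2 hr⟩, by simp⟩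
  have := Fintype.card_le_of_surjective _ h
  simpa [← pow_mul] using this

open Classical in
lemma aux_card_pairs {K : Type} [Field K] [Fintype K] {n h : ℕ} :
    (univ.filter (fun x : (Fin h → Fin n → K) × (Fin h → Fin n → K) =>
      ∀ i j, ip (x.1 i) (x.2 j) ≠ 0)).card ≤
    Fintype.card K ^ (n * n) * ((Fintype.card K - 1) ^ n * Fintype.card K ^ n) ^ h := by
  have : Fintype (Submodule K (Fin n → K)) := Fintype.ofFinite _
  set q := Fintype.card K with hq
  have hq2 : 1 < q := Fintype.one_lt_card
  have hW : ∀ W : Submodule K (Fin n → K),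
      ((univ.filter (fun x : (Fin h → Fin n → K) × (Fin h → Fin n → K) =>
      ∀ i j, ip (x.1 i) (x.2 j) ≠ 0)).filter
        (fun x => Submodule.span K (Set.range x.1) = W)).card ≤ ((q - 1) ^ n * q ^ n) ^ h := by
    intro W
    set r := Module.finrank K W with hr
    have hrn : r ≤ n := by simpa using Submodule.finrank_le W
    set S := (univ.filter (fun A : Fin h → Fin n → K => Submodule.span K (Set.range A) = W)) with hS
    have hScard : S.card ≤ (q ^ r) ^ h := by
      have h1 : S.card ≤ (Fintype.piFinset (fun _ : Fin h => univ.filter (fun v => v ∈ W))).card := by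
        apply Finset.card_le_card
        intro A hA
        simp only [hS, mem_filter, mem_univ, true_and] at hA
        simp only [Fintype.mem_piFinset, mem_filter, mem_univ, true_and]
        intro i
        rw [← hA]
        exact Submodule.subset_span ⟨i, rfl⟩
      have h2 : (univ.filter (fun v => v ∈ W)).card = q ^ r := by
        rw [← Fintype.card_subtype]
        exact Module.card_eq_pow_finrank
      simpa [Fintype.card_piFinset, h2] using h1
    have hB : ∀ A ∈ S, (univ.filter (fun B : Fin h → Fin n → K =>
        ∀ i j, ip (A i) (B j) ≠ 0)).card * (q ^ r) ^ h ≤ ((q - 1) ^ r * q ^ n) ^ h := by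
      intro A hA
      simp only [hS, mem_filter, mem_univ, true_and] at hA
      let T := univ.filter (fun b : Fin n → K => ∀ i, ip (A i) b ≠ 0)
      have h1 := aux_card_nonorth (Set.range A) T (by simpa [T] using fun b hb => hb)
      rw [hA, ← hq, ← hr] at h1
      have h2 : (univ.filter (fun B : Fin h → Fin n → K =>
        ∀ i j, ip (A i) (B j) ≠ 0)).card ≤ (Fintype.piFinset (fun _ : Fin h =>
T)).card := by
        apply Finset.card_le_card
        intro B hB
        simp only [mem_filter, mem_univ, true_and] at hB
        simp only [T, Fintype.mem_piFinset, mem_filter, mem_univ, true_and]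
        intro j i
        exact hB i j
      rw [Fintype.card_piFinset, Finset.prod_const, Finset.card_univ, Fintype.card_fin] at h2
      have h3 := Nat.pow_le_pow_left h1 h
      rw [mul_pow] at h3
      exact (Nat.mul_le_mul_right _ h2).trans h3
    have hsig : ((univ.filter (fun x : (Fin h → Fin n → K) × (Fin h → Fin n → K) =>
      ∀ i j, ip (x.1 i) (x.2 j) ≠ 0)).filter
        (fun x => Submodule.span K (Set.range x.1) = W)).card ≤
        ∑ A ∈ S, (univ.filter (fun B : Fin h → Fin n → K =>
        ∀ i j, ip (A i) (B j) ≠ 0)).card := by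
      rw [← Finset.card_sigma]
      apply Finset.card_le_card_of_injOn (fun x => (⟨x.1, x.2⟩ : Sigma fun _ => _))
      · rintro ⟨A, B⟩ hx
        simpa [hS, and_comm] using hx
      · rintro ⟨A, B⟩ - ⟨A', B'⟩ - hx
        simpa using hx
    have hpos : 0 < (q ^ r) ^ h := by positivity
    refine le_of_mul_le_mul_right ?_ hpos
    calc _ ≤ (∑ A ∈ S, (univ.filter (fun B : Fin h → Fin n → K =>
        ∀ i j, ip (A i) (B j) ≠ 0)).card) * (q ^ r) ^ h := Nat.mul_le_mul_right _ hsig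
      _ = ∑ A ∈ S, (univ.filter (fun B : Fin h → Fin n → K =>
        ∀ i j, ip (A i) (B j) ≠ 0)).card * (q ^ r) ^ h := by rw [Finset.sum_mul]
      _ ≤ ∑ A ∈ S, ((q - 1) ^ r * q ^ n) ^ h := Finset.sum_le_sum hB
      _ = S.card * ((q - 1) ^ r * q ^ n) ^ h := by simp
      _ ≤ (q ^ r) ^ h * ((q - 1) ^ n * q ^ n) ^ h := by
        gcongr
        omega
      _ = _ := mul_comm _ _
  rw [Finset.card_eq_sum_card_fiberwise (f := fun x => Submodule.span K (Set.range x.1))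
    (t := univ) (fun _ _ => by simp)]
  calc _ ≤ ∑ W : Submodule K (Fin n → K), ((q - 1) ^ n * q ^ n) ^ h :=
        Finset.sum_le_sum (fun W _ => hW W)
    _ = Fintype.card (Submodule K (Fin n → K)) * ((q - 1) ^ n * q ^ n) ^ h := by simp
    _ ≤ _ := Nat.mul_le_mul_right _ aux_card_submodule

open Classical in
lemma aux_card_Q {K : Type} [Field K] [Fintype K] {n : ℕ} (hn : 1 ≤ n) :
    Fintype.card K ^ n ≤ Fintype.card K * Fintype.card {v : Fin n → K // ip v v ≠ 0} := by
  obtain ⟨m, rfl⟩ : ∃ m, n = m + 1 := ⟨n - 1, by omega⟩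
  have h : ∀ x : Fin m → K, ∃ c : K, ip (Fin.cons c x : Fin (m+1) → K) (Fin.cons c x) ≠ 0 := by
    intro x
    by_cases h0 : ip x x = 0
    · refine ⟨1, ?_⟩
      unfold ip at *
      simp [Fin.sum_univ_succ, h0]
    · refine ⟨0, ?_⟩
      unfold ip at *
      simpa [Fin.sum_univ_succ] using h0
  choose c hc using h
  have hinj : Function.Injective
      (fun x : Fin m → K => (⟨Fin.cons (c x) x, hc x⟩ : {v : Fin (m+1) → K // ip v v ≠ 0})) := by
    intro x y hxy
    have := Subtype.ext_iff.1 hxy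
    dsimp only at this
    funext i
    simpa using congrFun this i.succ
  have := Fintype.card_le_of_injective _ hinj
  rw [pow_succ, mul_comm]
  apply Nat.mul_le_mul_left
  simpa using this

open Classical in
lemma aux_random {α : Type} [Fintype α] [Nonempty α] (R : α → α → Prop) (h t N M : ℕ)
    (hM : Fintype.card {x : (Fin h → α) × (Fin h → α) // ∀ i j, R (x.1 i) (x.2 j)} ≤ M)
    (hN : N ^ (2 * h) * M ^ t < (Fintype.card α) ^ (2 * h * t)) :
    ∃ f : Fin N → Fin t → α, ∀ e : (Fin h ⊕ Fin h) ↪ Fin N,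
      ∃ i j s, ¬ R (f (e (Sum.inl i)) s) (f (e (Sum.inr j)) s) := by
  by_contra hcon
  push Not at hcon
  let X : ((Fin h ⊕ Fin h) ↪ Fin N) → Finset (Fin N → Fin t → α) := fun e =>
    univ.filter (fun f => ∀ i j s, R (f (e (Sum.inl i)) s) (f (e (Sum.inr j)) s))
  have hX : ∀ e, (X e).card * Fintype.card (Fin h ⊕ Fin h → Fin t → α) ≤
      M ^ t * Fintype.card (Fin N → Fin t → α) := by
    intro e
    have hinj : Function.Injective (fun y : (X e) × (Fin h ⊕ Fin h → Fin t → α) =>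
        ((fun s => ⟨(fun i => y.1.1 (e (Sum.inl i)) s, fun j => y.1.1 (e (Sum.inr j)) s),
          fun i j => (Finset.mem_filter.1 y.1.2).2 i j s⟩, Function.extend e y.2 y.1.1) :
          (Fin t → {x : (Fin h → α) × (Fin h → α) // ∀ i j, R (x.1 i) (x.2 j)}) ×
            (Fin N → Fin t → α))) := by
      rintro ⟨⟨f, hf⟩, g⟩ ⟨⟨f', hf'⟩, g'⟩ hy
      simp only [Prod.mk.injEq] at hy
      obtain ⟨h1, h2⟩ := hy
      have hg : g = g' := by
        funext a
        have := congrFun h2 (e a)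
        simpa [e.injective.extend_apply] using this
      have hff : f = f' := by
        funext x
        by_cases hx : ∃ a, e a = x
        · obtain ⟨a, rfl⟩ := hx
          funext s
          have h3 := Subtype.ext_iff.1 (congrFun h1 s)
          simp only [Prod.mk.injEq] at h3
          cases a with
          | inl i => exact congrFun h3.1 i
          | inr j => exact congrFun h3.2 j
        · have := congrFun h2 x
          simpa [Function.extend_apply' _ _ _ hx] using this
      subst hg; subst hff; rfl
    have hc := Fintype.card_le_of_injective _ hinj
    rw [Fintype.card_prod, Fintype.card_prod, Fintype.card_coe] at hc
    refine hc.trans (Nat.mul_le_mul_right _ ?_)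
    rw [Fintype.card_fun, Fintype.card_fin]
    exact Nat.pow_le_pow_left hM t
  have hcover : (univ : Finset (Fin N → Fin t → α)) ⊆ univ.biUnion X := by
    intro f _
    obtain ⟨e, he⟩ := hcon f
    simp only [X, mem_biUnion, mem_univ, true_and, mem_filter]
    exact ⟨e, he⟩
  have h1 : Fintype.card (Fin N → Fin t → α) ≤ ∑ e, (X e).card :=
    (Finset.card_le_card hcover).trans Finset.card_biUnion_le
  have h2 : Fintype.card ((Fin h ⊕ Fin h) ↪ Fin N) ≤ N ^ (2 * h) := by
    have := Fintype.card_le_of_injective (fun e : (Fin h ⊕ Fin h) ↪ Fin N => (e : _ → _))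
      DFunLike.coe_injective
    simpa [two_mul] using this
  have h3 : Fintype.card (Fin h ⊕ Fin h → Fin t → α) = (Fintype.card α) ^ (2 * h * t) := by
    simp only [Fintype.card_fun, Fintype.card_sum, Fintype.card_fin]
    rw [← pow_mul]; ring_nf
  have hpos : 0 < Fintype.card (Fin N → Fin t → α) := Fintype.card_pos
  have h4 : Fintype.card (Fin N → Fin t → α) * Fintype.card (Fin h ⊕ Fin h → Fin t → α) ≤
      N ^ (2 * h) * M ^ t * Fintype.card (Fin N → Fin t → α) := by
    calc _ ≤ (∑ e, (X e).card) * Fintype.card (Fin h ⊕ Fin h → Fin t → α) :=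
          Nat.mul_le_mul_right _ h1
      _ = ∑ e, (X e).card * Fintype.card (Fin h ⊕ Fin h → Fin t → α) := by rw [Finset.sum_mul]
      _ ≤ ∑ e : ((Fin h ⊕ Fin h) ↪ Fin N), M ^ t * Fintype.card (Fin N → Fin t → α) :=
          Finset.sum_le_sum (fun e _ => hX e)
      _ = Fintype.card ((Fin h ⊕ Fin h) ↪ Fin N) * (M ^ t * Fintype.card (Fin N → Fin t → α)) := by
          rw [Finset.sum_const, smul_eq_mul, Finset.card_univ]
      _ ≤ N ^ (2 * h) * (M ^ t * Fintype.card (Fin N → Fin t → α)) := Nat.mul_le_mul_right _ h2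
      _ = _ := by ring
  rw [h3, mul_comm] at h4
  exact absurd (le_of_mul_le_mul_right h4 hpos) (not_le.2 hN)

/-- Tensor product of `t` vectors over `K`, coordinates mapped to `F` and padded to length `d`. -/
noncomputable def auxTensor {K F : Type} [Field K] [Field F] (φ : K →+* F) {n t d : ℕ}
    (e : (Fin t → Fin n) ↪ Fin d) (x : Fin t → Fin n → K) : Fin d → F :=
  Function.extend e (fun c => φ (∏ s, x s (c s))) 0

lemma aux_ip_tensor {K F : Type} [Field K] [Field F] (φ : K →+* F) {n t d : ℕ}
    (e : (Fin t → Fin n) ↪ Fin d) (x y : Fin t → Fin n → K) :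
    ip (auxTensor φ e x) (auxTensor φ e y) = φ (∏ s, ip (x s) (y s)) := by
  classical
  unfold ip auxTensor
  rw [Finset.prod_univ_sum, map_sum, Fintype.piFinset_univ]
  have h1 : ∀ c : Fin t → Fin n, φ (∏ s, x s (c s) * y s (c s)) =
      Function.extend e (fun c => φ (∏ s, x s (c s))) 0 (e c) *
      Function.extend e (fun c => φ (∏ s, y s (c s))) 0 (e c) := by
    intro c
    rw [e.injective.extend_apply, e.injective.extend_apply, Finset.prod_mul_distrib, map_mul]
  rw [Finset.sum_congr rfl (fun c _ => h1 c)]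
  symm
  rw [← Finset.sum_map univ e (fun i => Function.extend e (fun c => φ (∏ s, x s (c s))) 0 i *
      Function.extend e (fun c => φ (∏ s, y s (c s))) 0 i)]
  apply Finset.sum_subset (Finset.subset_univ _)
  intro i _ hi
  have hi' : ¬ ∃ a, e a = i := by simpa using hi
  rw [Function.extend_apply' _ _ _ hi']
  simp

lemma aux_image {F : Type} [Field F] {d N h k : ℕ} (hk : 2 * h ≤ k)
    (g : Fin N → Fin d → F) (hg : ∀ i, ip (g i) (g i) ≠ 0)
    (hgood : ∀ e : (Fin h ⊕ Fin h) ↪ Fin N,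
      ∃ i j, ip (g (e (Sum.inl i))) (g (e (Sum.inr j))) = 0) :
    ∃ G : Finset (Fin d → F), N ≤ k * G.card ∧ (∀ v ∈ G, ip v v ≠ 0) ∧
      (∀ G1 ⊆ G, ∀ G2 ⊆ G, G1.card = k → G2.card = k →
            ∃ v1 ∈ G1, ∃ v2 ∈ G2, ip v1 v2 = 0) := by
  classical
  have hfin : ∀ I J : Finset (Fin N), I.card = h → J.card = h → Disjoint I J →
      ∃ i ∈ I, ∃ j ∈ J, ip (g i) (g j) = 0 := by
    intro I J hI hJ hIJ
    let e : (Fin h ⊕ Fin h) → Fin N := Sum.elim (fun i => ((Finset.equivFinOfCardEq hI).symm i).1)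
      (fun i => ((Finset.equivFinOfCardEq hJ).symm i).1)
    have he : Function.Injective e := by
      apply Function.Injective.sumElim
      · exact Subtype.val_injective.comp (Equiv.injective _)
      · exact Subtype.val_injective.comp (Equiv.injective _)
      · intro a b hab
        exact Finset.disjoint_left.1 hIJ ((Finset.equivFinOfCardEq hI).symm a).2
          (by rw [hab]; exact ((Finset.equivFinOfCardEq hJ).symm b).2)
    obtain ⟨i, j, hij⟩ := hgood ⟨e, he⟩
    exact ⟨_, ((Finset.equivFinOfCardEq hI).symm i).2, _,
      ((Finset.equivFinOfCardEq hJ).symm j).2, hij⟩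
  have hsplit : ∀ S T : Finset (Fin N), k ≤ S.card → k ≤ T.card →
      ∃ i ∈ S, ∃ j ∈ T, ip (g i) (g j) = 0 := by
    intro S T hS hT
    obtain ⟨I, hIS, hI⟩ := Finset.exists_subset_card_eq (s := S) (n := h) (by omega)
    have h1 : h ≤ (T \ I).card := by
      have := Finset.le_card_sdiff I T
      omega
    obtain ⟨J, hJT, hJ⟩ := Finset.exists_subset_card_eq h1
    obtain ⟨i, hi, j, hj, hij⟩ := hfin I J hI hJ
      (Finset.disjoint_left.2 fun a ha hb => (Finset.mem_sdiff.1 (hJT hb)).2 ha)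
    exact ⟨i, hIS hi, j, (Finset.mem_sdiff.1 (hJT hj)).1, hij⟩
  refine ⟨univ.image g, ?_, ?_, ?_⟩
  · have := Finset.card_le_mul_card_image (f := g) univ k ?_
    · simpa using this
    · intro b _
      by_contra hlt
      push Not at hlt
      obtain ⟨i, hi, j, hj, hij⟩ := hsplit _ _ hlt.le hlt.le
      simp only [mem_filter, mem_univ, true_and] at hi hj
      apply hg i
      rw [← hij, hi, hj]
  · intro v hv
    obtain ⟨i, -, rfl⟩ := Finset.mem_image.1 hv
    exact hg i
  · intro G1 h1 G2 h2 hc1 hc2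
    obtain ⟨S, -, rfl⟩ := Finset.subset_image_iff.1 h1
    obtain ⟨T, -, rfl⟩ := Finset.subset_image_iff.1 h2
    obtain ⟨i, hi, j, hj, hij⟩ := hsplit S T (hc1 ▸ Finset.card_image_le)
      (hc2 ▸ Finset.card_image_le)
    exact ⟨_, Finset.mem_image_of_mem _ hi, _, Finset.mem_image_of_mem _ hj, hij⟩

lemma aux_construct (p : ℕ) (hp : p.Prime) (F : Type) [Field F] [CharP F p]
    (d k h n t N : ℕ) (hk : 2 * h ≤ k) (hn : 1 ≤ n) (hd : n ^ t ≤ d)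
    (hN : N ^ (2 * h) * (p ^ (n * n) * ((p - 1) ^ n * p ^ n) ^ h) ^ t * p ^ (2 * h * t)
      < p ^ (n * (2 * h * t))) :
    ∃ G : Finset (Fin d → F), N ≤ k * G.card ∧ (∀ v ∈ G, ip v v ≠ 0) ∧
      (∀ G1 ⊆ G, ∀ G2 ⊆ G, G1.card = k → G2.card = k →
            ∃ v1 ∈ G1, ∃ v2 ∈ G2, ip v1 v2 = 0) := by
  classical
  have : Fact p.Prime := ⟨hp⟩
  let α := {v : Fin n → ZMod p // ip v v ≠ 0}
  have hα : p ^ n ≤ p * Fintype.card α := by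
    have := aux_card_Q (K := ZMod p) hn
    rw [ZMod.card] at this
    convert this
  have hpp := hp.pos
  have : Nonempty α := by
    rw [← Fintype.card_pos_iff]
    have : 0 < p ^ n := by positivity
    exact Nat.pos_of_mul_pos_left (lt_of_lt_of_le this hα)
  have hM : Fintype.card {x : (Fin h → α) × (Fin h → α) // ∀ i j, ip (x.1 i).1 (x.2 j).1 ≠ 0} ≤
      p ^ (n * n) * ((p - 1) ^ n * p ^ n) ^ h := by
    have h1 := aux_card_pairs (K := ZMod p) (n := n) (h := h)
    rw [ZMod.card] at h1
    refine le_trans ?_ h1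
    rw [← Fintype.card_subtype]
    apply Fintype.card_le_of_injective
      (fun x : {x : (Fin h → α) × (Fin h → α) // ∀ i j, ip (x.1 i).1 (x.2 j).1 ≠ 0} =>
        ⟨(fun i => (x.1.1 i).1, fun i => (x.1.2 i).1), x.2⟩)
    rintro ⟨⟨A, B⟩, hx⟩ ⟨⟨A', B'⟩, hx'⟩ hy
    simp only [Subtype.mk.injEq, Prod.mk.injEq] at hy ⊢
    exact ⟨funext fun i => Subtype.ext (congrFun hy.1 i),
      funext fun i => Subtype.ext (congrFun hy.2 i)⟩
  obtain ⟨f, hf⟩ := aux_random (α := α) (fun a b => ip a.1 b.1 ≠ 0) h t N _ (by convert hM) (by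
    have h1 := Nat.pow_le_pow_left hα (2 * h * t)
    rw [← pow_mul, mul_pow] at h1
    have h2 := lt_of_lt_of_le hN h1
    rw [mul_comm] at h2
    exact lt_of_mul_lt_mul_left h2 (Nat.zero_le _))
  have hcard : Fintype.card (Fin t → Fin n) ≤ Fintype.card (Fin d) := by simpa using hd
  obtain ⟨e⟩ := Function.Embedding.nonempty_of_card_le hcard
  let φ : ZMod p →+* F := ZMod.castHom dvd_rfl F
  apply aux_image hk (fun i => auxTensor φ e (fun s => (f i s).1))
  · intro i
    rw [aux_ip_tensor, ne_eq, map_eq_zero, Finset.prod_eq_zero_iff]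
    rintro ⟨s, -, hs⟩
    exact (f i s).2 hs
  · intro e'
    obtain ⟨i, j, s, hs⟩ := hf e'
    refine ⟨i, j, ?_⟩
    rw [aux_ip_tensor, map_eq_zero, Finset.prod_eq_zero_iff]
    exact ⟨s, mem_univ _, not_not.1 hs⟩

lemma aux_ineq (p : ℕ) (hp : p.Prime) (L n h t N : ℕ)
    (hL : (p : ℝ) ≤ ((p : ℝ) / ((p : ℝ) - 1)) ^ L) (hL1 : 1 ≤ L)
    (hn : 8 * L ≤ n) (hh : 4 * L * n ≤ h)
    (hN : (N : ℝ) ^ 4 < ((p : ℝ) / ((p : ℝ) - 1)) ^ (n * t)) :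
    N ^ (2 * h) * (p ^ (n * n) * ((p - 1) ^ n * p ^ n) ^ h) ^ t * p ^ (2 * h * t)
      < p ^ (n * (2 * h * t)) := by
  have hp2 : (2 : ℝ) ≤ p := by exact_mod_cast hp.two_le
  set ρ : ℝ := (p : ℝ) / ((p : ℝ) - 1) with hρ
  have hρ1 : 1 < ρ := by rw [hρ, lt_div_iff₀ (by linarith)]; linarith
  have hρ0 : 0 < ρ := by linarith
  have hp0 : (0 : ℝ) < p := by linarith
  have hpm : ((p - 1 : ℕ) : ℝ) * ρ = p := by
    rw [Nat.cast_sub hp.one_le, hρ]; push_cast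
    have : (p : ℝ) - 1 ≠ 0 := by linarith
    field_simp
  have hh1 : 1 ≤ h := by nlinarith
  -- key real inequality
  have key : (N : ℝ) ^ (2 * h) * (p : ℝ) ^ (t * (n * n + 2 * h)) < ρ ^ (n * h * t) := by
    refine lt_of_pow_lt_pow_left₀ 2 (by positivity) ?_
    have e1 : ((N : ℝ) ^ 4) ^ h < (ρ ^ (n * t)) ^ h :=
      pow_lt_pow_left₀ hN (by positivity) (by omega)
    have e2 : (p : ℝ) ^ (2 * t * (n * n + 2 * h)) ≤ ρ ^ (n * h * t) := by
      calc (p : ℝ) ^ (2 * t * (n * n + 2 * h)) ≤ (ρ ^ L) ^ (2 * t * (n * n + 2 * h)) := by gcongr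
        _ = ρ ^ (L * (2 * t * (n * n + 2 * h))) := (pow_mul _ _ _).symm
        _ ≤ _ := by
          apply pow_le_pow_right₀ hρ1.le
          have : 2 * (L * (n * n + 2 * h)) ≤ n * h := by nlinarith
          nlinarith
    calc ((N : ℝ) ^ (2 * h) * (p : ℝ) ^ (t * (n * n + 2 * h))) ^ 2
        = ((N : ℝ) ^ 4) ^ h * (p : ℝ) ^ (2 * t * (n * n + 2 * h)) := by
          rw [mul_pow, ← pow_mul, ← pow_mul, ← pow_mul]; ring_nf
      _ < (ρ ^ (n * t)) ^ h * ρ ^ (n * h * t) :=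
          mul_lt_mul e1 e2 (by positivity) (by positivity)
      _ = (ρ ^ (n * h * t)) ^ 2 := by rw [← pow_mul, ← pow_mul, ← pow_add]; ring_nf
  have hfin : ((N ^ (2 * h) * (p ^ (n * n) * ((p - 1) ^ n * p ^ n) ^ h) ^ t * p ^ (2 * h * t) : ℕ) : ℝ)
      * ρ ^ (n * h * t) < ((p ^ (n * (2 * h * t)) : ℕ) : ℝ) * ρ ^ (n * h * t) := by
    have e3 : ((N ^ (2 * h) * (p ^ (n * n) * ((p - 1) ^ n * p ^ n) ^ h) ^ t * p ^ (2 * h * t) : ℕ) : ℝ)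
      * ρ ^ (n * h * t) = ((N : ℝ) ^ (2 * h) * (p : ℝ) ^ (t * (n * n + 2 * h))) *
        ((((p - 1 : ℕ) : ℝ) * ρ) ^ (n * h * t) * (p : ℝ) ^ (n * h * t)) := by
      push_cast
      simp only [mul_pow, ← pow_mul, mul_add, pow_add]
      ring_nf
    rw [e3, hpm]
    have e4 : ((p ^ (n * (2 * h * t)) : ℕ) : ℝ) = (p : ℝ) ^ (n * h * t) * (p : ℝ) ^ (n * h * t) := by
      push_cast; rw [← pow_add]; ring_nf
    rw [e4, mul_comm ((p : ℝ) ^ (n * h * t) * (p : ℝ) ^ (n * h * t))]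
    exact mul_lt_mul_of_pos_right key (by positivity)
  have := lt_of_mul_lt_mul_right hfin (by positivity)
  exact_mod_cast this

lemma aux_small (F : Type) [Field F] (d k : ℕ) (hk : 2 ≤ k) :
    ∃ G : Finset (Fin d → F), G.card = d ∧ (∀ v ∈ G, ip v v ≠ 0) ∧
      (∀ G1 ⊆ G, ∀ G2 ⊆ G, G1.card = k → G2.card = k →
            ∃ v1 ∈ G1, ∃ v2 ∈ G2, ip v1 v2 = 0) := by
  classical
  have hip : ∀ i j : Fin d, ip (Pi.single i (1 : F)) (Pi.single j 1) = if i = j then 1 else 0 := by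
    intro i j
    unfold ip
    simp [Pi.single_apply, eq_comm]
  refine ⟨univ.image (fun i => Pi.single i (1 : F)), ?_, ?_, ?_⟩
  · rw [Finset.card_image_of_injective]
    · simp
    · intro i j hij
      by_contra hne
      have := congrFun hij i
      simp [hne] at this
  · intro v hv
    obtain ⟨i, -, rfl⟩ := Finset.mem_image.1 hv
    simp [hip]
  · intro G1 h1 G2 h2 hc1 hc2
    obtain ⟨v, hv⟩ := Finset.card_pos.1 (by omega : 0 < G1.card)
    obtain ⟨w, hw, hne⟩ := Finset.exists_mem_ne (by omega : 1 < G2.card) v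
    refine ⟨v, hv, w, hw, ?_⟩
    obtain ⟨i, -, rfl⟩ := Finset.mem_image.1 (h1 hv)
    obtain ⟨j, -, rfl⟩ := Finset.mem_image.1 (h2 hw)
    rw [hip, if_neg]
    rintro rfl
    exact hne rfl

lemma aux_asymp (b : ℝ) (hb : 0 < b) (m : ℕ) : ∃ K : ℝ, ∀ x, K ≤ x → 2 * x ^ m < Real.exp (b * x) := by
  have h := (isLittleO_pow_exp_pos_mul_atTop m hb).bound (by norm_num : (0 : ℝ) < 1 / 3)
  obtain ⟨K, hK⟩ := Filter.eventually_atTop.1 h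
  refine ⟨K, fun x hx => ?_⟩
  have h1 := hK x hx
  rw [Real.norm_eq_abs, Real.norm_eq_abs, Real.abs_exp] at h1
  have := le_abs_self (x ^ m)
  have := Real.exp_pos (b * x)
  linarith

end NearlyOrth

set_option maxHeartbeats 1000000 in
/-- for every prime `p` there is `δ = δ(p) > 0` such that for every
field `F` of characteristic `p` and all integers `k ≥ 2` and `d ≥ k^{1/(p-1)}`,
there is a set `G` of non-self-orthogonal vectors of `F^d` with
`|G| ≥ d^{δ k^{1/(p-1)} / log k}`, such that any two `k`-element subsets
`G1, G2 ⊆ G` contain an orthogonal pair `v1 ∈ G1`, `v2 ∈ G2`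
(logarithms in base 2). -/
theorem nearly_orthogonal_bipartite (p : ℕ) (hp : p.Prime) :
    ∃ δ : ℝ, 0 < δ ∧
      ∀ (F : Type) [Field F] [CharP F p], ∀ d k : ℕ, 2 ≤ k →
        (k : ℝ) ^ ((1 : ℝ) / ((p : ℝ) - 1)) ≤ (d : ℝ) →
        ∃ G : Finset (Fin d → F),
          (d : ℝ) ^ (δ * (k : ℝ) ^ ((1 : ℝ) / ((p : ℝ) - 1)) / Real.logb 2 k)
            ≤ (G.card : ℝ) ∧
          (∀ v ∈ G, ip v v ≠ 0) ∧
          (∀ G1 ⊆ G, ∀ G2 ⊆ G, G1.card = k → G2.card = k →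
            ∃ v1 ∈ G1, ∃ v2 ∈ G2, ip v1 v2 = 0) := by
  have hp2 : (2 : ℝ) ≤ p := by exact_mod_cast hp.two_le
  obtain ⟨ρ, hρ⟩ : ∃ ρ : ℝ, ρ = (p : ℝ) / ((p : ℝ) - 1) := ⟨_, rfl⟩
  have hρ1 : 1 < ρ := by rw [hρ, lt_div_iff₀ (by linarith)]; linarith
  have hρ0 : 0 < ρ := by linarith
  have hlogρ : 0 < Real.log ρ := Real.log_pos hρ1
  obtain ⟨L, hL1, hL⟩ : ∃ L : ℕ, 1 ≤ L ∧ (p : ℝ) ≤ ρ ^ L := by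
    obtain ⟨L, hL⟩ := pow_unbounded_of_one_lt (p : ℝ) hρ1
    refine ⟨L + 1, by omega, hL.le.trans ?_⟩
    exact pow_le_pow_right₀ hρ1.le (by omega)
  have hLr : (1 : ℝ) ≤ L := by exact_mod_cast hL1
  have hL0 : (0 : ℝ) < L := by linarith
  obtain ⟨K, hK⟩ := aux_asymp (Real.log ρ / (192 * L)) (by positivity) (p - 1)
  obtain ⟨K0, hK0, hK0L⟩ : ∃ K0 : ℝ, K ≤ K0 ∧ 96 * (L : ℝ) * L ≤ K0 :=
    ⟨max K (96 * L * L), le_max_left _ _, le_max_right _ _⟩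
  have hK0pos : 0 < K0 := by nlinarith
  refine ⟨min (Real.log ρ / (384 * L)) (1 / K0), by positivity, ?_⟩
  intro F _ _ d k hk hd
  set δ := min (Real.log ρ / (384 * L)) (1 / K0) with hδ
  have hδ0 : 0 < δ := by positivity
  set κ : ℝ := (k : ℝ) ^ ((1 : ℝ) / ((p : ℝ) - 1)) with hκ
  have hk2 : (2 : ℝ) ≤ k := by exact_mod_cast hk
  have hκ1 : 1 ≤ κ := Real.one_le_rpow (by linarith) (div_nonneg zero_le_one (by linarith))
  have hκk : κ ≤ k := by
    calc κ ≤ (k : ℝ) ^ (1 : ℝ) := Real.rpow_le_rpow_of_exponent_le (by linarith) (by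
          rw [div_le_one (by linarith)]; linarith)
      _ = k := Real.rpow_one _
  have hκpow : κ ^ (p - 1) = k := by
    rw [hκ, ← Real.rpow_natCast, ← Real.rpow_mul (by linarith), Nat.cast_sub hp.one_le,
      Nat.cast_one, one_div_mul_cancel (by linarith), Real.rpow_one]
  have hlogk : 1 ≤ Real.logb 2 k := by
    rw [Real.le_logb_iff_rpow_le (by norm_num) (by linarith)]; simpa using hk2
  have hd1 : (1 : ℝ) ≤ d := hκ1.trans hd
  by_cases hcase : κ < K0
  · obtain ⟨G, hG, h1, h2⟩ := aux_small F d k hk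
    refine ⟨G, ?_, h1, h2⟩
    rw [hG]
    calc (d : ℝ) ^ (δ * κ / Real.logb 2 k) ≤ (d : ℝ) ^ (1 : ℝ) := by
          apply Real.rpow_le_rpow_of_exponent_le hd1
          rw [div_le_one (by linarith)]
          have : δ ≤ 1 / K0 := min_le_right _ _
          have h3 : δ * κ ≤ 1 / K0 * K0 := by gcongr
          rw [one_div_mul_cancel hK0pos.ne'] at h3
          linarith
      _ = d := Real.rpow_one _
  push Not at hcase
  obtain ⟨n, hn⟩ : ∃ n : ℕ, n = ⌊κ / (12 * L)⌋₊ := ⟨_, rfl⟩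
  have hn1 : (n : ℝ) ≤ κ / (12 * L) := by
    rw [hn]; exact Nat.floor_le (by positivity)
  have hn1' : 12 * L * (n : ℝ) ≤ κ := by
    rw [le_div_iff₀ (by positivity)] at hn1; linarith
  have hn8 : 8 * L ≤ n := by
    rw [hn]; apply Nat.le_floor
    rw [le_div_iff₀ (by positivity)]; push_cast; linarith
  have hn2 : κ ≤ 24 * L * n := by
    have h1 : κ / (12 * L) < n + 1 := by rw [hn]; exact Nat.lt_floor_add_one _
    rw [div_lt_iff₀ (by positivity)] at h1
    have h2 : (8 : ℝ) * L ≤ n := by exact_mod_cast hn8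
    nlinarith
  have hnk : 12 * L * n ≤ k := by
    have : 12 * (L : ℝ) * n ≤ k := hn1'.trans hκk
    exact_mod_cast this
  have hnκ : (n : ℝ) ≤ κ := by
    have : (0 : ℝ) ≤ n := Nat.cast_nonneg _
    nlinarith
  have hnd : n ≤ d := by exact_mod_cast hnκ.trans hd
  have hn2' : 2 ≤ n := by omega
  obtain ⟨t, ht⟩ : ∃ t : ℕ, t = Nat.log n d := ⟨_, rfl⟩
  have ht1 : 1 ≤ t := by
    rw [ht]; exact Nat.log_pos (by omega) hnd
  have htd : n ^ t ≤ d := by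
    rw [ht]; apply Nat.pow_log_le_self; have := (by exact_mod_cast hd1 : 1 ≤ d); omega
  have hdt : d ≤ n ^ (2 * t) := by
    have h1 : d < n ^ (t + 1) := by rw [ht]; exact Nat.lt_pow_succ_log_self (by omega) d
    exact h1.le.trans (Nat.pow_le_pow_right (by omega) (by omega))
  have htr : (1 : ℝ) ≤ t := by exact_mod_cast ht1
  have hn0r : (0 : ℝ) < n := by exact_mod_cast (by omega : 0 < n)
  obtain ⟨y, hy⟩ : ∃ y : ℝ, y = Real.exp (Real.log ρ * (n * t) / 8) := ⟨_, rfl⟩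
  have hy0 : 0 < y := by rw [hy]; exact Real.exp_pos _
  have hy8 : y ^ 8 = ρ ^ (n * t) := by
    rw [hy, ← Real.exp_nat_mul, ← Real.exp_log (pow_pos hρ0 (n * t)), Real.log_pow]
    congr 1; push_cast; ring
  have hky : 2 * (k : ℝ) < y := by
    rw [← hκpow, hy]
    refine lt_of_lt_of_le (hK κ (hK0.trans hcase)) (Real.exp_le_exp.2 ?_)
    rw [div_mul_eq_mul_div, div_le_div_iff₀ (by positivity) (by norm_num)]
    have h1 : κ ≤ 24 * L * (n * t) := hn2.trans (by
      rw [← mul_assoc]; exact le_mul_of_one_le_right (by positivity) htr)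
    nlinarith
  obtain ⟨N, hN⟩ : ∃ N : ℕ, N = ⌈(k : ℝ) * y⌉₊ := ⟨_, rfl⟩
  have hN1 : (k : ℝ) * y ≤ N := by rw [hN]; exact Nat.le_ceil _
  have hN2 : (N : ℝ) < y ^ 2 := by
    have : (N : ℝ) < k * y + 1 := by rw [hN]; exact Nat.ceil_lt_add_one (by positivity)
    nlinarith
  have hN4 : (N : ℝ) ^ 4 < ρ ^ (n * t) := by
    rw [← hy8, show y ^ 8 = (y ^ 2) ^ 4 by ring]
    exact pow_lt_pow_left₀ hN2 (by positivity) (by norm_num)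
  rw [hρ] at hL hN4
  have hfour : 4 * L * n ≤ k / 2 := by
    rw [Nat.le_div_iff_mul_le (by norm_num)]
    have h0 := Nat.zero_le (L * n)
    rw [mul_assoc] at hnk ⊢
    linarith only [hnk, h0]
  obtain ⟨G, hG, h1, h2⟩ := aux_construct p hp F d k (k / 2) n t N (by omega) (by omega) htd
    (aux_ineq p hp L n (k / 2) t N hL hL1 hn8 hfour hN4)
  refine ⟨G, ?_, h1, h2⟩
  have hGy : y ≤ G.card := by
    have h3 : (N : ℝ) ≤ k * G.card := by exact_mod_cast hG
    exact le_of_mul_le_mul_left (hN1.trans h3) (by linarith)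
  refine le_trans ?_ hGy
  rw [hy, Real.rpow_def_of_pos (by linarith)]
  apply Real.exp_le_exp.2
  have hlogd : Real.log d ≤ 2 * t * Real.logb 2 k := by
    have e1 : Real.log d ≤ 2 * t * Real.log n := by
      have : (d : ℝ) ≤ (n : ℝ) ^ (2 * t) := by exact_mod_cast hdt
      have := Real.log_le_log (by linarith) this
      rw [Real.log_pow] at this
      push_cast at this
      exact this
    have e2 : Real.log n ≤ Real.log k := Real.log_le_log hn0r (hnκ.trans hκk)
    have e3 : Real.log k ≤ Real.logb 2 k := by
      rw [Real.logb, le_div_iff₀ (Real.log_pos (by norm_num))]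
      have := Real.log_nonneg (by linarith : (1 : ℝ) ≤ k)
      have := Real.log_two_lt_d9
      nlinarith
    calc _ ≤ _ := e1
      _ ≤ _ := by gcongr; exact e2.trans e3
  have hδ1 : δ * (384 * L) ≤ Real.log ρ := by
    rw [← le_div_iff₀ (by positivity)]; exact min_le_left _ _
  calc Real.log d * (δ * κ / Real.logb 2 k)
      ≤ (2 * t * Real.logb 2 k) * (δ * κ / Real.logb 2 k) := by gcongr
    _ = 2 * t * δ * κ := by
      have : Real.logb 2 k ≠ 0 := by linarith
      field_simp
    _ ≤ 2 * t * δ * (24 * L * n) := by gcongr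
    _ = (δ * (384 * L)) * (n * t) / 8 := by ring
    _ ≤ _ := by gcongr
end

section
/- Let p be a fixed prime. For all integers t ≥ 2, the number N_{p,t} of subsets A of F_p^t such that every vector of A is non-self-orthogonal and every two distinct vectors of A are non-orthogonal satisfies 2^{c1·p^{t/2}} ≤ N_{p,t} ≤ 2^{c2·p^{t/2}} for positive constants c1, c2 depending only on p. -/
section helpers
open Finset

lemma ip_add_right' {F : Type*} [CommRing F] {ι : Type*} [Fintype ι] (x v w : ι → F) (a : F) :
    ip x (v + a • w) = ip x v + a * ip x w := by
  simp only [ip, Pi.add_apply, Pi.smul_apply, smul_eq_mul, mul_add, Finset.sum_add_distrib,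
    Finset.mul_sum]
  congr 1
  exact Finset.sum_congr rfl fun i _ => by ring

lemma ip_comm' {F : Type*} [CommRing F] {ι : Type*} [Fintype ι] (x y : ι → F) :
    ip x y = ip y x := by
  simp only [ip]
  exact Finset.sum_congr rfl fun i _ => mul_comm _ _

lemma ip_single {F : Type*} [CommRing F] {t : ℕ} (x : Fin t → F) (j : Fin t) (a : F) :
    ip x (Pi.single j a) = x j * a := by
  simp [ip, Pi.single_apply]

/-- Balanced indicator of zero. -/
def hh (p : ℕ) (a : ZMod p) : ℤ := if a = 0 then (p : ℤ) - 1 else -1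

lemma exists_sep {F : Type*} [Field F] {t : ℕ} (x y : Fin t → F) (hxy : ¬ ∃ c : F, y = c • x) :
    ∃ w, ip x w = 0 ∧ ip y w ≠ 0 := by
  by_contra hcon
  push Not at hcon
  apply hxy
  by_cases hx : x = 0
  · refine ⟨0, ?_⟩
    funext j
    have := hcon (Pi.single j 1) (by simp [hx, ip])
    rw [ip_single] at this
    simpa using this
  · obtain ⟨i, hi⟩ := Function.ne_iff.mp hx
    have hi' : x i ≠ 0 := hi
    refine ⟨y i / x i, ?_⟩
    funext j
    have := hcon (Pi.single j (x i) + (-x j) • Pi.single i 1)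
      (by rw [ip_add_right', ip_single, ip_single]; ring)
    rw [ip_add_right', ip_single, ip_single] at this
    simp only [Pi.smul_apply, smul_eq_mul]
    field_simp
    linear_combination this

lemma hh_sum (p : ℕ) [Fact p.Prime] (c d : ZMod p) (hd : d ≠ 0) :
    ∑ a : ZMod p, hh p (c + a * d) = 0 := by
  have hiff : ∀ a : ZMod p, c + a * d = 0 ↔ a = -c / d := by
    intro a
    rw [eq_div_iff hd]
    constructor
    · intro h; linear_combination h
    · intro h; linear_combination h
  have : ∀ a : ZMod p, hh p (c + a * d) = (if a = -c / d then (p : ℤ) else 0) - 1 := by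
    intro a
    simp only [hh, hiff]
    split_ifs <;> simp
  simp [this, ZMod.card]

lemma hh_orth (p t : ℕ) [Fact p.Prime] (x y : Fin t → ZMod p)
    (hxy : ¬ ∃ c : ZMod p, y = c • x) :
    ∑ v : Fin t → ZMod p, hh p (ip x v) * hh p (ip y v) = 0 := by
  obtain ⟨w, hw1, hw2⟩ := exists_sep x y hxy
  have h1 : ∀ a : ZMod p, ∑ v : Fin t → ZMod p, hh p (ip x v) * hh p (ip y v)
      = ∑ v : Fin t → ZMod p, hh p (ip x v) * hh p (ip y v + a * ip y w) := by
    intro a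
    rw [← Equiv.sum_comp (Equiv.addRight (a • w))]
    refine Finset.sum_congr rfl fun v _ => ?_
    simp only [Equiv.coe_addRight, ip_add_right', hw1, mul_zero, add_zero]
  have h2 : ∑ _a : ZMod p, ∑ v : Fin t → ZMod p, hh p (ip x v) * hh p (ip y v) = 0 := by
    rw [Finset.sum_congr rfl fun a _ => h1 a, Finset.sum_comm]
    refine Finset.sum_eq_zero fun v _ => ?_
    rw [← Finset.mul_sum, hh_sum p _ _ hw2, mul_zero]
  rw [Finset.sum_const, Finset.card_univ, ZMod.card, nsmul_eq_mul] at h2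
  have hp : (p : ℤ) ≠ 0 := by exact_mod_cast (Fact.out : p.Prime).ne_zero
  exact (mul_eq_zero.mp h2).resolve_left hp

lemma hh_mul_le (p : ℕ) [Fact p.Prime] (a b : ZMod p) : hh p a * hh p b ≤ (p : ℤ) ^ 2 := by
  have hp : (2 : ℤ) ≤ p := by exact_mod_cast (Fact.out : p.Prime).two_le
  unfold hh
  split_ifs <;> nlinarith

lemma moment (p t : ℕ) [Fact p.Prime] (C : Finset (Fin t → ZMod p)) :
    ∑ v : Fin t → ZMod p, (∑ x ∈ C, hh p (ip x v)) ^ 2 ≤ (#C : ℤ) * (p : ℤ) ^ (t + 3) := by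
  classical
  have e : ∑ v : Fin t → ZMod p, (∑ x ∈ C, hh p (ip x v)) ^ 2
      = ∑ x ∈ C, ∑ y ∈ C, ∑ v : Fin t → ZMod p, hh p (ip x v) * hh p (ip y v) := by
    simp only [sq, Finset.sum_mul_sum]
    rw [Finset.sum_comm]
    exact Finset.sum_congr rfl fun x _ => Finset.sum_comm
  rw [e, ← nsmul_eq_mul]
  refine Finset.sum_le_card_nsmul _ _ _ fun x _ => ?_
  have h1 : ∀ y, ∑ v : Fin t → ZMod p, hh p (ip x v) * hh p (ip y v)
      ≤ if ∃ c : ZMod p, y = c • x then (p : ℤ) ^ (t + 2) else 0 := by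
    intro y
    split_ifs with h
    · calc _ ≤ ∑ v : Fin t → ZMod p, (p : ℤ) ^ 2 := Finset.sum_le_sum fun v _ => hh_mul_le p _ _
        _ = _ := by simp [ZMod.card, pow_add]
    · exact (hh_orth p t x y h).le
  refine (Finset.sum_le_sum fun y _ => h1 y).trans ?_
  rw [← Finset.sum_filter, Finset.sum_const, nsmul_eq_mul]
  have h2 : #(C.filter fun y => ∃ c : ZMod p, y = c • x) ≤ p := by
    calc _ ≤ #((univ : Finset (ZMod p)).image fun c => c • x) := by
          apply Finset.card_le_card
          intro y hy
          obtain ⟨-, c, hc⟩ := Finset.mem_filter.mp hy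
          exact Finset.mem_image.mpr ⟨c, mem_univ _, hc.symm⟩
      _ ≤ _ := Finset.card_image_le
      _ = p := by simp [ZMod.card]
  calc _ ≤ (p : ℤ) * (p : ℤ) ^ (t + 2) := by gcongr
    _ = _ := by ring

/-- Vectors orthogonal to few members of `C`. -/
def bad (p t : ℕ) [Fact p.Prime] (C : Finset (Fin t → ZMod p)) : Finset (Fin t → ZMod p) :=
  univ.filter fun v => 2 * p * #(C.filter fun x => ip x v = 0) ≤ #C

lemma bad_card (p t : ℕ) [Fact p.Prime] (C : Finset (Fin t → ZMod p)) :
    #(bad p t C) * #C ≤ 4 * p ^ (t + 3) := by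
  rcases Nat.eq_zero_or_pos (#C) with h0 | hpos
  · simp [h0]
  have h1 : ∀ v, ∑ x ∈ C, hh p (ip x v) = p * (#(C.filter fun x => ip x v = 0) : ℤ) - #C := by
    intro v
    have : ∀ x, hh p (ip x v) = (if ip x v = 0 then (p : ℤ) else 0) - 1 := by
      intro x; unfold hh; split_ifs <;> simp
    simp only [this, Finset.sum_sub_distrib, ← Finset.sum_filter, Finset.sum_const]
    simp [mul_comm]
  have h2 : (#(bad p t C) : ℤ) * (#C : ℤ) ^ 2
      ≤ ∑ v : Fin t → ZMod p, 4 * (∑ x ∈ C, hh p (ip x v)) ^ 2 := by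
    calc _ ≤ ∑ v ∈ bad p t C, 4 * (∑ x ∈ C, hh p (ip x v)) ^ 2 := by
          rw [← nsmul_eq_mul]
          refine Finset.card_nsmul_le_sum _ _ _ fun v hv => ?_
          have hv' := (Finset.mem_filter.mp hv).2
          have hv2 : 2 * (p : ℤ) * (#(C.filter fun x => ip x v = 0) : ℤ) ≤ #C := by
            exact_mod_cast hv'
          rw [h1]
          have hC : (0 : ℤ) ≤ #C := by positivity
          nlinarith
      _ ≤ _ := Finset.sum_le_sum_of_subset_of_nonneg (Finset.subset_univ _)
          fun _ _ _ => by positivity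
  rw [← Finset.mul_sum] at h2
  have h3 := moment p t C
  have h4 : (#C : ℤ) * ((#(bad p t C) : ℤ) * #C) ≤ (#C : ℤ) * (4 * (p : ℤ) ^ (t + 3)) := by
    nlinarith
  have h5 := le_of_mul_le_mul_left h4 (by exact_mod_cast hpos)
  exact_mod_cast h5

/-- The property being counted. -/
def Gd (p t : ℕ) (A : Finset (Fin t → ZMod p)) : Prop :=
  (∀ v ∈ A, ip v v ≠ 0) ∧ ∀ v1 ∈ A, ∀ v2 ∈ A, v1 ≠ v2 → ip v1 v2 ≠ 0

open Classical in
lemma recursion (p t M : ℕ) [Fact p.Prime] (hM : 4 * p ^ (t + 3) ≤ M * M) (k : ℕ) :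
    ∀ C : Finset (Fin t → ZMod p), #C * (2 * p - 1) ^ k ≤ M * (2 * p) ^ k →
      #(C.powerset.filter (Gd p t)) ≤ (p ^ t + 1) ^ k * 2 ^ M := by
  have hp : 2 ≤ p := (Fact.out : p.Prime).two_le
  have base : ∀ C : Finset (Fin t → ZMod p), #C ≤ M →
      #(C.powerset.filter (Gd p t)) ≤ 2 ^ M := by
    intro C hC
    refine (Finset.card_filter_le _ _).trans ?_
    rw [Finset.card_powerset]
    exact Nat.pow_le_pow_right (by norm_num) hC
  induction k with
  | zero => intro C hC; simpa using base C (by simpa using hC)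
  | succ k ih =>
    intro C hC
    by_cases hCM : #C ≤ M
    · exact (base C hCM).trans (Nat.le_mul_of_pos_left _ (by positivity))
    push Not at hCM
    have hB : #(bad p t C) ≤ M := by
      by_contra hlt
      push Not at hlt
      have := bad_card p t C
      nlinarith
    have hsub : C.powerset.filter (Gd p t) ⊆ (bad p t C).powerset ∪
        ((univ : Finset (Fin t → ZMod p)) \ bad p t C).biUnion fun v =>
          ((C.filter fun x => ip x v ≠ 0).powerset.filter (Gd p t)) := by
      intro A hA
      obtain ⟨hAC, hG⟩ := Finset.mem_filter.mp hA
      rw [Finset.mem_powerset] at hAC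
      by_cases hAB : A ⊆ bad p t C
      · exact Finset.mem_union_left _ (Finset.mem_powerset.mpr hAB)
      · obtain ⟨v, hvA, hvB⟩ := Finset.not_subset.mp hAB
        apply Finset.mem_union_right
        refine Finset.mem_biUnion.mpr ⟨v, by simp [hvB], ?_⟩
        refine Finset.mem_filter.mpr ⟨Finset.mem_powerset.mpr fun x hx => ?_, hG⟩
        refine Finset.mem_filter.mpr ⟨hAC hx, ?_⟩
        by_cases hxv : x = v
        · subst hxv; exact hG.1 _ hx
        · exact hG.2 _ hx _ hvA hxv
    have hstep : ∀ v ∈ (univ : Finset (Fin t → ZMod p)) \ bad p t C,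
        #((C.filter fun x => ip x v ≠ 0).powerset.filter (Gd p t)) ≤ (p ^ t + 1) ^ k * 2 ^ M := by
      intro v hv
      apply ih
      have hv' : ¬ (2 * p * #(C.filter fun x => ip x v = 0) ≤ #C) := by
        simpa [bad] using hv
      have hs := Finset.card_filter_add_card_filter_not (s := C) (fun x => ip x v = 0)
      obtain ⟨q, hq⟩ : ∃ q, 2 * p = q + 1 := ⟨2 * p - 1, by omega⟩
      rw [hq] at hC hv' ⊢
      simp only [Nat.add_sub_cancel] at hC ⊢
      have h1 : (q + 1) * #(C.filter fun x => ip x v ≠ 0) ≤ #C * q := by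
        simp only [ne_eq]
        nlinarith
      have h2 : (q + 1) * (#(C.filter fun x => ip x v ≠ 0) * q ^ k)
          ≤ (q + 1) * (M * (q + 1) ^ k) := by
        calc _ = (q + 1) * #(C.filter fun x => ip x v ≠ 0) * q ^ k := by ring
          _ ≤ #C * q * q ^ k := by gcongr
          _ = #C * q ^ (k + 1) := by ring
          _ ≤ _ := hC
          _ = _ := by ring
      exact le_of_mul_le_mul_left h2 (by omega)
    calc _ ≤ _ := Finset.card_le_card hsub
      _ ≤ _ := Finset.card_union_le _ _
      _ ≤ 2 ^ M + p ^ t * ((p ^ t + 1) ^ k * 2 ^ M) := by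
        gcongr
        · rw [Finset.card_powerset]
          exact Nat.pow_le_pow_right (by norm_num) hB
        · refine (Finset.card_biUnion_le_card_mul _ _ _ hstep).trans ?_
          gcongr
          refine (Finset.card_le_univ _).trans ?_
          simp [ZMod.card]
      _ ≤ (p ^ t + 1) ^ k * 2 ^ M + p ^ t * ((p ^ t + 1) ^ k * 2 ^ M) := by
        gcongr
        exact Nat.le_mul_of_pos_left _ (by positivity)
      _ = _ := by ring

lemma bern (q : ℕ) : 2 * q ^ (q + 1) ≤ (q + 1) ^ (q + 1) := by
  rcases Nat.eq_zero_or_pos q with h | h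
  · subst h; norm_num
  have h0 : (0 : ℝ) < q := by exact_mod_cast h
  have := one_add_mul_le_pow (a := 1 / (q : ℝ)) (by
    have : 0 < 1 / (q : ℝ) := by positivity
    linarith) (q + 1)
  have h2 : (2 : ℝ) ≤ (1 + 1 / (q : ℝ)) ^ (q + 1) := by
    refine le_trans ?_ this
    push_cast
    field_simp
    linarith
  have h3 : (1 + 1 / (q : ℝ)) * q = q + 1 := by field_simp
  have h4 : (2 : ℝ) * q ^ (q + 1) ≤ (q + 1) ^ (q + 1) := by
    rw [← h3, mul_pow]
    gcongr
  exact_mod_cast h4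

lemma upper_nat (p t : ℕ) [Fact p.Prime] :
    {A : Finset (Fin t → ZMod p) | Gd p t A}.ncard
      ≤ 2 ^ ((p * t + 1) * (2 * p * (p * t)) + 2 * p ^ (t / 2 + 2)) := by
  classical
  have hp : 2 ≤ p := (Fact.out : p.Prime).two_le
  have hpp : p ≤ 2 ^ p := Nat.lt_two_pow_self.le
  have hpt : p ^ t ≤ 2 ^ (p * t) := by
    rw [pow_mul]; exact Nat.pow_le_pow_left hpp t
  set M := 2 * p ^ (t / 2 + 2) with hMdef
  have hM : 4 * p ^ (t + 3) ≤ M * M := by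
    have : M * M = 4 * p ^ (2 * (t / 2) + 4) := by rw [hMdef]; ring
    rw [this]
    exact Nat.mul_le_mul_left _ (Nat.pow_le_pow_right (by omega) (by omega))
  have hMpos : 1 ≤ M := by rw [hMdef]; have : 0 < p ^ (t / 2 + 2) := by positivity
                           omega
  have key := recursion p t M hM (2 * p * (p * t)) univ (by
    obtain ⟨q, hq⟩ : ∃ q, 2 * p = q + 1 := ⟨2 * p - 1, by omega⟩
    rw [hq]
    simp only [Nat.add_sub_cancel, Finset.card_univ, Fintype.card_pi, ZMod.card,
      Finset.prod_const, Fintype.card_fin]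
    rw [pow_mul q, pow_mul (q + 1)]
    calc p ^ t * (q ^ (q + 1)) ^ (p * t) ≤ 2 ^ (p * t) * (q ^ (q + 1)) ^ (p * t) := by gcongr
      _ = (2 * q ^ (q + 1)) ^ (p * t) := by rw [mul_pow]
      _ ≤ ((q + 1) ^ (q + 1)) ^ (p * t) := Nat.pow_le_pow_left (bern q) _
      _ ≤ _ := Nat.le_mul_of_pos_left _ hMpos)
  have e : {A : Finset (Fin t → ZMod p) | Gd p t A}
      = ((univ : Finset (Fin t → ZMod p)).powerset.filter (Gd p t) : Finset _) := by
    ext A; simp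
  rw [e, Set.ncard_coe_finset]
  refine key.trans ?_
  rw [pow_add, pow_mul 2 (p * t + 1)]
  refine Nat.mul_le_mul_right _ (Nat.pow_le_pow_left ?_ _)
  rw [pow_succ]
  have : 1 ≤ 2 ^ (p * t) := Nat.one_le_two_pow
  omega

lemma lower_set (p : ℕ) [Fact p.Prime] : ∀ t : ℕ, 1 ≤ t →
    ∃ S : Finset (Fin t → ZMod p), p ^ t ≤ p ^ 4 * #S ^ 2 ∧ ∀ x ∈ S, ∀ y ∈ S, ip x y = 1 := by
  classical
  have hp : 2 ≤ p := (Fact.out : p.Prime).two_le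
  obtain ⟨a, b, hab⟩ := ZMod.sq_add_sq p (-1)
  intro t
  induction t using Nat.strong_induction_on with
  | _ t ih =>
  intro ht
  by_cases h4 : t ≤ 4
  · refine ⟨{Pi.single ⟨0, ht⟩ 1}, ?_, ?_⟩
    · simpa using Nat.pow_le_pow_right (by omega) h4
    · simp [ip_single]
  · obtain ⟨s, rfl⟩ : ∃ s, t = s + 4 := ⟨t - 4, by omega⟩
    obtain ⟨S, hS1, hS2⟩ := ih s (by omega) (by omega)
    let φ : ZMod p × ZMod p × (Fin s → ZMod p) → (Fin (s + 4) → ZMod p) := fun z =>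
      Fin.cons z.1 (Fin.cons z.2.1 (Fin.cons (a * z.1 - b * z.2.1)
        (Fin.cons (b * z.1 + a * z.2.1) z.2.2 : Fin (s + 1) → ZMod p) :
          Fin (s + 2) → ZMod p) : Fin (s + 3) → ZMod p)
    have hφ : Function.Injective φ := by
      rintro ⟨u, w, x⟩ ⟨u', w', x'⟩ h
      simp only [φ] at h
      obtain ⟨h1, h⟩ := Fin.cons_injective2 h
      obtain ⟨h2, h⟩ := Fin.cons_injective2 h
      obtain ⟨-, h⟩ := Fin.cons_injective2 h
      obtain ⟨-, h⟩ := Fin.cons_injective2 h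
      simp_all
    refine ⟨(univ ×ˢ univ ×ˢ S).image φ, ?_, ?_⟩
    · rw [Finset.card_image_of_injective _ hφ]
      simp only [Finset.card_product, Finset.card_univ, ZMod.card]
      calc p ^ (s + 4) = p ^ 4 * p ^ s := by ring
        _ ≤ p ^ 4 * (p ^ 4 * #S ^ 2) := by gcongr
        _ = _ := by ring
    · intro x hx y hy
      obtain ⟨⟨u, w, x⟩, hx1, rfl⟩ := Finset.mem_image.mp hx
      obtain ⟨⟨u', w', y⟩, hy1, rfl⟩ := Finset.mem_image.mp hy
      have hx' : x ∈ S := by simpa using hx1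
      have hy' : y ∈ S := by simpa using hy1
      have := hS2 x hx' y hy'
      simp only [ip, φ] at this ⊢
      rw [Fin.sum_univ_succ, Fin.sum_univ_succ, Fin.sum_univ_succ, Fin.sum_univ_succ]
      simp only [Fin.cons_zero, Fin.cons_succ]
      rw [this]
      linear_combination (u * u' + w * w') * hab

lemma lower_nat (p t : ℕ) [Fact p.Prime] (S : Finset (Fin t → ZMod p))
    (hS : ∀ x ∈ S, ∀ y ∈ S, ip x y = 1) :
    2 ^ #S ≤ {A : Finset (Fin t → ZMod p) | Gd p t A}.ncard := by
  rw [← Finset.card_powerset, ← Set.ncard_coe_finset]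
  refine Set.ncard_le_ncard ?_ (Set.toFinite _)
  intro A hA
  have hA' : A ⊆ S := by simpa using hA
  refine ⟨fun v hv => ?_, fun v hv w hw _ => ?_⟩
  · rw [hS v (hA' hv) v (hA' hv)]; exact one_ne_zero
  · rw [hS v (hA' hv) w (hA' hw)]; exact one_ne_zero

lemma sq_le_rpow (p t : ℕ) (hp : 2 ≤ p) : (t : ℝ) ^ 2 ≤ 20 * (p : ℝ) ^ ((t : ℝ) / 2) := by
  have h1 : (2 : ℝ) ^ ((t : ℝ) / 2) ≤ (p : ℝ) ^ ((t : ℝ) / 2) := by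
    apply Real.rpow_le_rpow (by norm_num) (by exact_mod_cast hp) (by positivity)
  have h2 : (2 : ℝ) ^ ((t : ℝ) / 2) = Real.exp (Real.log 2 * ((t : ℝ) / 2)) := by
    rw [Real.rpow_def_of_pos (by norm_num)]
  have hl := Real.log_two_gt_d9
  have ht : (0 : ℝ) ≤ t := by positivity
  have hy : 0.33 * (t : ℝ) ≤ Real.log 2 * ((t : ℝ) / 2) := by nlinarith
  have h3 := Real.quadratic_le_exp_of_nonneg (x := 0.33 * (t : ℝ)) (by positivity)
  have h4 := Real.exp_le_exp.mpr hy
  rw [← h2] at h4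
  nlinarith

end helpers

/-- for a fixed prime `p`, the number `N_{p,t}` of subsets of
`F_p^t` consisting of non-self-orthogonal, pairwise non-orthogonal vectors
satisfies `2^{c1 p^{t/2}} ≤ N_{p,t} ≤ 2^{c2 p^{t/2}}` for all `t ≥ 2`, for
positive constants `c1, c2` depending only on `p`. -/
theorem counting_pairwise_non_orthogonal (p : ℕ) (hp : p.Prime) :
    ∃ c1 c2 : ℝ, 0 < c1 ∧ 0 < c2 ∧ ∀ t : ℕ, 2 ≤ t →
      (2 : ℝ) ^ (c1 * (p : ℝ) ^ ((t : ℝ) / 2)) ≤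
        (({A : Finset (Fin t → ZMod p) | (∀ v ∈ A, ip v v ≠ 0) ∧
          ∀ v1 ∈ A, ∀ v2 ∈ A, v1 ≠ v2 → ip v1 v2 ≠ 0}.ncard : ℝ)) ∧
      (({A : Finset (Fin t → ZMod p) | (∀ v ∈ A, ip v v ≠ 0) ∧
          ∀ v1 ∈ A, ∀ v2 ∈ A, v1 ≠ v2 → ip v1 v2 ≠ 0}.ncard : ℝ)) ≤
        (2 : ℝ) ^ (c2 * (p : ℝ) ^ ((t : ℝ) / 2)) := by
  haveI : Fact p.Prime := ⟨hp⟩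
  have hp2 := hp.two_le
  have hpR : (2 : ℝ) ≤ p := by exact_mod_cast hp2
  have hp0 : (0 : ℝ) < p := by linarith
  refine ⟨1 / (p : ℝ) ^ 2, 80 * (p : ℝ) ^ 3 + 2 * (p : ℝ) ^ 2, by positivity, by positivity, ?_⟩
  intro t ht
  have hsq : ((p : ℝ) ^ ((t : ℝ) / 2)) ^ 2 = (p : ℝ) ^ t := by
    rw [← Real.rpow_natCast, ← Real.rpow_mul hp0.le, ← Real.rpow_natCast]
    congr 1
    push_cast
    ring
  have hRpos : 0 < (p : ℝ) ^ ((t : ℝ) / 2) := by positivity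
  constructor
  · obtain ⟨S, hS1, hS2⟩ := lower_set p t (by omega)
    have h := lower_nat p t S hS2
    have hS1' : (p : ℝ) ^ t ≤ (p : ℝ) ^ 4 * (S.card : ℝ) ^ 2 := by exact_mod_cast hS1
    have h1 : (p : ℝ) ^ ((t : ℝ) / 2) ≤ (p : ℝ) ^ 2 * S.card := by
      apply le_of_sq_le_sq _ (by positivity)
      rw [hsq]
      refine hS1'.trans (le_of_eq ?_)
      ring
    calc (2 : ℝ) ^ (1 / (p : ℝ) ^ 2 * (p : ℝ) ^ ((t : ℝ) / 2)) ≤ (2 : ℝ) ^ (S.card : ℝ) := by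
          apply Real.rpow_le_rpow_of_exponent_le (by norm_num)
          rw [one_div, inv_mul_le_iff₀ (by positivity)]
          exact h1
      _ = ((2 ^ S.card : ℕ) : ℝ) := by rw [Real.rpow_natCast]; push_cast; rfl
      _ ≤ _ := by exact_mod_cast h
  · have h := upper_nat p t
    have h' : (({A : Finset (Fin t → ZMod p) | Gd p t A}.ncard : ℕ) : ℝ)
      ≤ ((2 ^ ((p * t + 1) * (2 * p * (p * t)) + 2 * p ^ (t / 2 + 2)) : ℕ) : ℝ) := by
      exact_mod_cast h
    refine le_trans h' ?_
    rw [Nat.cast_pow, ← Real.rpow_natCast, Nat.cast_ofNat]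
    apply Real.rpow_le_rpow_of_exponent_le (by norm_num)
    have h1 : (p : ℝ) ^ (t / 2) ≤ (p : ℝ) ^ ((t : ℝ) / 2) := by
      rw [← Real.rpow_natCast]
      apply Real.rpow_le_rpow_of_exponent_le (by linarith)
      exact Nat.cast_div_le
    have h2 := sq_le_rpow p t hp2
    have htR : (2 : ℝ) ≤ t := by exact_mod_cast ht
    push_cast
    have h3 : ((p : ℝ) * t + 1) * (2 * p * (p * t)) ≤ 4 * (p : ℝ) ^ 3 * (t : ℝ) ^ 2 := by
      have : (p : ℝ) * t + 1 ≤ 2 * (p * t) := by nlinarith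
      calc _ ≤ (2 * ((p : ℝ) * t)) * (2 * p * (p * t)) := by gcongr
        _ = _ := by ring
    have h4 : 4 * (p : ℝ) ^ 3 * (t : ℝ) ^ 2 ≤ 4 * (p : ℝ) ^ 3 * (20 * (p : ℝ) ^ ((t : ℝ) / 2)) := by
      gcongr
    have h5 : 2 * (p : ℝ) ^ (t / 2 + 2) ≤ 2 * (p : ℝ) ^ 2 * (p : ℝ) ^ ((t : ℝ) / 2) := by
      rw [pow_add, mul_comm ((p : ℝ) ^ (t / 2)), ← mul_assoc]
      gcongr
    linarith
end
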